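/- arXiv:math/0401069 — 2 statements merged into one kernel-verified Lean document; each statement's English description precedes it below -/
import Mathlib

section
/- Let 𝔾 be a finite connected transitive graph. The susceptibility χ(p) is a polynomial function of p, and for every p ∈ (0,1) its derivative satisfies [1 − ∇̄_p]·Ω·χ(p)² ≤ dχ(p)/dp ≤ Ω·χ(p)². -/
noncomputable section
open Classical

namespace Percolation

variable {V : Type*} [Fintype V] [DecidableEq V]

/-- A percolation configuration: an assignment of occupied (`true`) or
vacant (`false`) to each bond of the graph. -/
def Config (G : SimpleGraph V) : Type _ := G.edgeSet → Bool

noncomputable instance (G : SimpleGraph V) : Fintype G.edgeSet :=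
  Fintype.ofFinite _

noncomputable instance (G : SimpleGraph V) : Fintype (Config G) :=
  inferInstanceAs (Fintype (G.edgeSet → Bool))

/-- The probability weight of a configuration under the product Bernoulli
measure with parameter `p`. -/
def weight (G : SimpleGraph V) (p : ℝ) (ω : Config G) : ℝ :=
  ∏ e : G.edgeSet, if ω e then p else 1 - p

/-- The probability of an event under the percolation measure `ℙ_p`. -/
def prob (G : SimpleGraph V) (p : ℝ) (A : Config G → Prop) : ℝ :=
  ∑ ω : Config G, if A ω then weight G p ω else 0

/-- The expectation of a random variable under the percolation measure `ℙ_p`. -/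
def expect (G : SimpleGraph V) (p : ℝ) (f : Config G → ℝ) : ℝ :=
  ∑ ω : Config G, weight G p ω * f ω

/-- The subgraph consisting of the occupied bonds of a configuration. -/
def occupied (G : SimpleGraph V) (ω : Config G) : SimpleGraph V :=
  SimpleGraph.fromEdgeSet {e | ∃ h : e ∈ G.edgeSet, ω ⟨e, h⟩ = true}

/-- The cluster `C(x)` of the vertex `x`: all vertices joined to `x` by a path
of occupied bonds (including `x` itself). -/
def cluster (G : SimpleGraph V) (ω : Config G) (x : V) : Finset V :=
  Finset.univ.filter fun y => (occupied G ω).Reachable x y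

/-- The susceptibility `χ(p)`: the expected size of the cluster of `x₀`. -/
def chi (G : SimpleGraph V) (x₀ : V) (p : ℝ) : ℝ :=
  expect G p fun ω => ((cluster G ω x₀).card : ℝ)

/-- The two-point function `τ_p(x,y) = ℙ_p(x ↔ y)`. -/
def tau (G : SimpleGraph V) (p : ℝ) (x y : V) : ℝ :=
  prob G p fun ω => (occupied G ω).Reachable x y

/-- The triangle diagram `∇_p(x,y)`. -/
def triangle (G : SimpleGraph V) (p : ℝ) (x y : V) : ℝ :=
  ∑ u : V, ∑ v : V, tau G p x u * tau G p u v * tau G p v y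

/-- The Kronecker delta `δ_{x,y}`. -/
def kron (x y : V) : ℝ := if x = y then 1 else 0

/-- `∇̄_p`: the maximum of the triangle diagram over bonds `{x,y} ∈ 𝔹`. -/
def nablaBar (G : SimpleGraph V) (p : ℝ) : ℝ :=
  sSup {t : ℝ | ∃ x y : V, G.Adj x y ∧ t = triangle G p x y}

/-- A graph is (vertex-)transitive if any vertex can be mapped to any other
by a graph automorphism. -/
def IsTransitive (G : SimpleGraph V) : Prop :=
  ∀ x y : V, ∃ φ : G ≃g G, φ x = y

/-- The size `|C_max|` of the largest cluster. -/
def maxCluster (G : SimpleGraph V) (ω : Config G) : ℕ :=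
  Finset.univ.sup fun x => (cluster G ω x).card

/-- The cluster size distribution `P_{≥k}(p) = ℙ_p(|C(x₀)| ≥ k)`. -/
def Pgeq (G : SimpleGraph V) (x₀ : V) (p : ℝ) (k : ℝ) : ℝ :=
  prob G p fun ω => k ≤ ((cluster G ω x₀).card : ℝ)

/-- The magnetization `M(p,γ)`. -/
def magnetization (G : SimpleGraph V) (x₀ : V) (p γ : ℝ) : ℝ :=
  ∑ k ∈ Finset.Icc 1 (Fintype.card V),
    (1 - (1 - γ) ^ k) * prob G p fun ω => (cluster G ω x₀).card = k

/-- `Z_{≥s}`: the number of vertices lying in clusters of size at least `s`. -/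
def Zgeq (G : SimpleGraph V) (s : ℝ) (ω : Config G) : ℝ :=
  ∑ x : V, if s ≤ ((cluster G ω x).card : ℝ) then (1 : ℝ) else 0

/-- The variance of a random variable under `ℙ_p`. -/
def variance (G : SimpleGraph V) (p : ℝ) (f : Config G → ℝ) : ℝ :=
  expect G p (fun ω => f ω ^ 2) - (expect G p f) ^ 2

/-- The restricted susceptibility `χ_{≥s}(p) = 𝔼_p[|C(x₀)| I[|C(x₀)| ≥ s]]`. -/
def chiGeq (G : SimpleGraph V) (x₀ : V) (p : ℝ) (s : ℝ) : ℝ :=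
  expect G p fun ω =>
    if s ≤ ((cluster G ω x₀).card : ℝ) then ((cluster G ω x₀).card : ℝ) else 0

/-- The restricted susceptibility `χ_{<s}(p) = 𝔼_p[|C(x₀)| I[|C(x₀)| < s]]`. -/
def chiLt (G : SimpleGraph V) (x₀ : V) (p : ℝ) (s : ℝ) : ℝ :=
  expect G p fun ω =>
    if ((cluster G ω x₀).card : ℝ) < s then ((cluster G ω x₀).card : ℝ) else 0

end Percolation

set_option linter.unusedSectionVars false

/-! General finite product Bernoulli expectations on subsets of a finite set. -/
namespace PA

variable {E : Type*} [DecidableEq E]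

def w (p : ℝ) (S ω : Finset E) : ℝ := ∏ e ∈ S, if e ∈ ω then p else 1 - p

def Ex (p : ℝ) (S : Finset E) (f : Finset E → ℝ) : ℝ := ∑ ω ∈ S.powerset, w p S ω * f ω

def ind (A : Prop) : ℝ := if A then 1 else 0

lemma ind_nonneg (A : Prop) : 0 ≤ ind A := by unfold ind; split_ifs <;> norm_num

lemma ind_le {A B : Prop} (h : A → B) : ind A ≤ ind B := by
  unfold ind; split_ifs <;> first | (exfalso; tauto) | norm_num

lemma ind_congr {A B : Prop} (h : A ↔ B) : ind A = ind B := by rw [propext h]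

lemma ind_and (A B : Prop) : ind (A ∧ B) = ind A * ind B := by
  unfold ind; split_ifs <;> first | (exfalso; tauto) | norm_num

lemma ind_true {A : Prop} (h : A) : ind A = 1 := if_pos h
lemma ind_false {A : Prop} (h : ¬ A) : ind A = 0 := if_neg h

lemma w_nonneg {p : ℝ} (h0 : 0 ≤ p) (h1 : p ≤ 1) (S ω : Finset E) : 0 ≤ w p S ω := by
  apply Finset.prod_nonneg
  intro e _
  split_ifs <;> linarith

lemma w_insert_out (p : ℝ) {S ω : Finset E} {e : E} (he : e ∉ S) (hω : ω ⊆ S) :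
    w p (insert e S) ω = (1 - p) * w p S ω := by
  unfold w
  rw [Finset.prod_insert he, if_neg (fun h => he (hω h))]

lemma w_insert_in (p : ℝ) {S ω : Finset E} {e : E} (he : e ∉ S) :
    w p (insert e S) (insert e ω) = p * w p S ω := by
  unfold w
  rw [Finset.prod_insert he, if_pos (Finset.mem_insert_self _ _)]
  congr 1
  apply Finset.prod_congr rfl
  intro x hx
  have : x ≠ e := fun h => he (h ▸ hx)
  simp [Finset.mem_insert, this]

lemma Ex_empty (p : ℝ) (f : Finset E → ℝ) : Ex p ∅ f = f ∅ := by
  simp [Ex, w]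

lemma Ex_insert (p : ℝ) {S : Finset E} {e : E} (he : e ∉ S) (f : Finset E → ℝ) :
    Ex p (insert e S) f = (1 - p) * Ex p S f + p * Ex p S (fun ω => f (insert e ω)) := by
  unfold Ex
  rw [Finset.sum_powerset_insert he, Finset.mul_sum, Finset.mul_sum]
  congr 1
  · apply Finset.sum_congr rfl
    intro ω hω
    rw [w_insert_out p he (Finset.mem_powerset.1 hω)]; ring
  · apply Finset.sum_congr rfl
    intro ω hω
    rw [w_insert_in p he]; ring

lemma Ex_congr (p : ℝ) (S : Finset E) {f g : Finset E → ℝ} (h : ∀ ω ⊆ S, f ω = g ω) :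
    Ex p S f = Ex p S g :=
  Finset.sum_congr rfl fun ω hω => by rw [h ω (Finset.mem_powerset.1 hω)]

lemma Ex_mono {p : ℝ} (h0 : 0 ≤ p) (h1 : p ≤ 1) (S : Finset E) {f g : Finset E → ℝ}
    (h : ∀ ω ⊆ S, f ω ≤ g ω) : Ex p S f ≤ Ex p S g :=
  Finset.sum_le_sum fun ω hω =>
    mul_le_mul_of_nonneg_left (h ω (Finset.mem_powerset.1 hω)) (w_nonneg h0 h1 S ω)

lemma Ex_nonneg {p : ℝ} (h0 : 0 ≤ p) (h1 : p ≤ 1) (S : Finset E) {f : Finset E → ℝ}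
    (h : ∀ ω, 0 ≤ f ω) : 0 ≤ Ex p S f :=
  Finset.sum_nonneg fun ω _ => mul_nonneg (w_nonneg h0 h1 S ω) (h ω)

lemma Ex_add (p : ℝ) (S : Finset E) (f g : Finset E → ℝ) :
    Ex p S (fun ω => f ω + g ω) = Ex p S f + Ex p S g := by
  simp only [Ex, mul_add, Finset.sum_add_distrib]

lemma Ex_sub (p : ℝ) (S : Finset E) (f g : Finset E → ℝ) :
    Ex p S (fun ω => f ω - g ω) = Ex p S f - Ex p S g := by
  simp only [Ex, mul_sub, Finset.sum_sub_distrib]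

lemma Ex_mul_const (p : ℝ) (S : Finset E) (f : Finset E → ℝ) (c : ℝ) :
    Ex p S (fun ω => f ω * c) = Ex p S f * c := by
  simp only [Ex, Finset.sum_mul, mul_assoc]

lemma Ex_sum {ι : Type*} (p : ℝ) (S : Finset E) (s : Finset ι) (f : ι → Finset E → ℝ) :
    Ex p S (fun ω => ∑ i ∈ s, f i ω) = ∑ i ∈ s, Ex p S (f i) := by
  simp only [Ex, Finset.mul_sum]
  rw [Finset.sum_comm]

lemma Ex_one (p : ℝ) (S : Finset E) : Ex p S (fun _ => 1) = 1 := by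
  induction S using Finset.induction_on with
  | empty => rw [Ex_empty]
  | insert e S he ih => rw [Ex_insert p he, ih]; ring

/-- independence -/
lemma Ex_indep (p : ℝ) (S T : Finset E) : ∀ (f g : Finset E → ℝ)
    (_ : ∀ ω, f ω = f (ω ∩ T)) (_ : ∀ ω, g ω = g (ω \ T)),
    Ex p S (fun ω => f ω * g ω) = Ex p S f * Ex p S g := by
  induction S using Finset.induction_on with
  | empty => intro f g _ _; simp only [Ex_empty]
  | insert e S he ih =>
    intro f g hf hg
    simp only [Ex_insert p he]
    by_cases heT : e ∈ T
    · have hg' : ∀ ω, g (insert e ω) = g ω := by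
        intro ω
        rw [hg, hg ω, Finset.insert_sdiff_of_mem _ heT]
      have h1 := ih (fun ω => f (insert e ω)) g (by
        intro ω
        show f _ = f _
        rw [hf, hf (insert e (ω ∩ T))]
        congr 1
        ext x; simp only [Finset.mem_inter, Finset.mem_insert]; tauto) hg
      have h2 := ih f g hf hg
      simp only [hg'] at *
      rw [h1, h2]; ring
    · have hf' : ∀ ω, f (insert e ω) = f ω := by
        intro ω
        rw [hf, hf ω, Finset.insert_inter_of_notMem heT]
      have h1 := ih f (fun ω => g (insert e ω)) hf (by
        intro ω
        show g _ = g _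
        rw [hg, hg (insert e (ω \ T))]
        congr 1
        ext x; simp only [Finset.mem_sdiff, Finset.mem_insert]; tauto)
      have h2 := ih f g hf hg
      simp only [hf'] at *
      rw [h1, h2]; ring

/-- Russo's formula -/
lemma Ex_russo (p : ℝ) (S : Finset E) : ∀ f : Finset E → ℝ,
    HasDerivAt (fun p => Ex p S f)
      (∑ e ∈ S, Ex p S (fun ω => f (insert e ω) - f (ω.erase e))) p := by
  induction S using Finset.induction_on with
  | empty => intro f; simp only [Ex_empty, Finset.sum_empty]; exact hasDerivAt_const _ _
  | insert e S he ih =>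
    intro f
    have hd : HasDerivAt (fun p => (1 - p) * Ex p S f + p * Ex p S (fun ω => f (insert e ω)))
      _ p := ((((hasDerivAt_const p (1:ℝ)).sub (hasDerivAt_id p)).mul (ih f)).add
        ((hasDerivAt_id p).mul (ih (fun ω => f (insert e ω)))))
    simp only [Ex_insert _ he]
    refine hd.congr_deriv ?_
    rw [Finset.sum_insert he, Finset.sum_add_distrib, ← Finset.mul_sum, ← Finset.mul_sum]
    have h1 : Ex p S (fun ω => f (insert e ω) - f (ω.erase e))
        = Ex p S (fun ω => f (insert e ω)) - Ex p S f := by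
      rw [← Ex_sub]
      apply Ex_congr
      intro ω hω
      rw [Finset.erase_eq_of_notMem (fun h => he (hω h))]
    have h2 : Ex p S (fun ω => f (insert e (insert e ω)) - f ((insert e ω).erase e))
        = Ex p S (fun ω => f (insert e ω)) - Ex p S f := by
      rw [← Ex_sub]
      apply Ex_congr
      intro ω hω
      rw [Finset.erase_insert (fun h => he (hω h)), Finset.insert_idem]
    have h3 : ∑ e' ∈ S, Ex p S (fun ω => f (insert e' (insert e ω)) - f ((insert e ω).erase e'))
        = ∑ e' ∈ S, Ex p S (fun ω => f (insert e (insert e' ω)) - f (insert e (ω.erase e'))) := by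
      apply Finset.sum_congr rfl
      intro e' he'
      apply Ex_congr
      intro ω hω
      have hne : e ≠ e' := fun h => he (h ▸ he')
      rw [Finset.insert_comm, Finset.erase_insert_of_ne hne]
    rw [h1, h2, h3]
    simp only [id, Pi.sub_apply]
    ring

/-- disjoint occurrence -/
def Dj (A B : Finset E → Prop) (ω : Finset E) : Prop :=
  ∃ I J, I ⊆ ω ∧ J ⊆ ω ∧ Disjoint I J ∧ A I ∧ B J

lemma Dj_mono (A B : Finset E → Prop) : Monotone (Dj A B) := by
  rintro ω ω' h ⟨I, J, hI, hJ, hd, hA, hB⟩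
  exact ⟨I, J, hI.trans h, hJ.trans h, hd, hA, hB⟩

lemma Dj_imp {A B A' B' : Finset E → Prop} (hA : ∀ ω, A ω → A' ω) (hB : ∀ ω, B ω → B' ω)
    {ω : Finset E} (h : Dj A B ω) : Dj A' B' ω := by
  obtain ⟨I, J, hI, hJ, hd, h1, h2⟩ := h
  exact ⟨I, J, hI, hJ, hd, hA _ h1, hB _ h2⟩

/-- van den Berg-Kesten inequality -/
lemma bk {p : ℝ} (h0 : 0 ≤ p) (h1 : p ≤ 1) (S : Finset E) : ∀ (A B : Finset E → Prop)
    (_ : Monotone A) (_ : Monotone B),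
    Ex p S (fun ω => ind (Dj A B ω)) ≤ Ex p S (fun ω => ind (A ω)) * Ex p S (fun ω => ind (B ω)) := by
  induction S using Finset.induction_on with
  | empty =>
    intro A B hA hB
    simp only [Ex_empty]
    rw [← ind_and]
    apply ind_le
    rintro ⟨I, J, hI, hJ, hd, h1, h2⟩
    exact ⟨hA hI h1, hB hJ h2⟩
  | insert e S he ih =>
    intro A B hA hB
    simp only [Ex_insert p he]
    set A1 : Finset E → Prop := fun ω => A (insert e ω) with hA1
    set B1 : Finset E → Prop := fun ω => B (insert e ω) with hB1
    have mi : Monotone (fun ω : Finset E => insert e ω) := fun ω ω' h => Finset.insert_subset_insert e h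
    have mA1 : Monotone A1 := hA.comp mi
    have mB1 : Monotone B1 := hB.comp mi
    have iA : ∀ ω, A ω → A1 ω := fun ω h => hA (Finset.subset_insert e ω) h
    have iB : ∀ ω, B ω → B1 ω := fun ω h => hB (Finset.subset_insert e ω) h
    have k00 := ih A B hA hB
    have k01 := ih A B1 hA mB1
    have k10 := ih A1 B mA1 hB
    have k11 := ih A1 B1 mA1 mB1
    have key : ∀ ω ⊆ S, Dj A B (insert e ω) → Dj A B1 ω ∨ Dj A1 B ω := by
      rintro ω hω ⟨I, J, hI, hJ, hd, h1, h2⟩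
      by_cases heI : e ∈ I
      · right
        have heJ : e ∉ J := Finset.disjoint_left.1 hd heI
        refine ⟨I.erase e, J, ?_, ?_, ?_, ?_, h2⟩
        · rwa [← Finset.subset_insert_iff]
        · rwa [← Finset.subset_insert_iff_of_notMem heJ]
        · exact hd.mono_left (Finset.erase_subset _ _)
        · show A _
          rwa [Finset.insert_erase heI]
      · left
        refine ⟨I, J.erase e, ?_, ?_, ?_, h1, ?_⟩
        · rwa [← Finset.subset_insert_iff_of_notMem heI]
        · rwa [← Finset.subset_insert_iff]
        · exact hd.mono_right (Finset.erase_subset _ _)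
        · show B _
          exact hB (Finset.insert_erase_subset e J) h2
    have b1 : Ex p S (fun ω => ind (Dj A B (insert e ω))) ≤
        Ex p S (fun ω => ind (Dj A B1 ω)) + Ex p S (fun ω => ind (Dj A1 B ω))
          - Ex p S (fun ω => ind (Dj A B ω)) := by
      rw [← Ex_add, ← Ex_sub]
      apply Ex_mono h0 h1
      intro ω hω
      have k := key ω hω
      have k1 : Dj A B ω → Dj A B1 ω := Dj_imp (fun _ h => h) iB
      have k2 : Dj A B ω → Dj A1 B ω := Dj_imp iA (fun _ h => h)
      generalize Dj A B (insert e ω) = q0 at k ⊢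
      generalize Dj A B1 ω = q1 at k k1 ⊢
      generalize Dj A1 B ω = q2 at k k2 ⊢
      generalize Dj A B ω = q3 at k1 k2 ⊢
      unfold ind
      by_cases q0 <;> by_cases q1 <;> by_cases q2 <;> by_cases q3 <;> simp_all
    have b2 : Ex p S (fun ω => ind (Dj A B (insert e ω))) ≤ Ex p S (fun ω => ind (Dj A1 B1 ω)) := by
      apply Ex_mono h0 h1
      intro ω hω
      apply ind_le
      intro h
      rcases key ω hω h with h | h
      · exact Dj_imp iA (fun _ h => h) h
      · exact Dj_imp (fun _ h => h) iB h
    have hp : 0 ≤ 1 - p := by linarith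
    have c1 := mul_le_mul_of_nonneg_left b1 (mul_nonneg h0 hp)
    have c2 := mul_le_mul_of_nonneg_left b2 (mul_nonneg h0 h0)
    have d00 := mul_le_mul_of_nonneg_left k00 (mul_nonneg hp hp)
    have d01 := mul_le_mul_of_nonneg_left k01 (mul_nonneg h0 hp)
    have d10 := mul_le_mul_of_nonneg_left k10 (mul_nonneg h0 hp)
    have d11 := mul_le_mul_of_nonneg_left k11 (mul_nonneg h0 h0)
    linarith [c1, c2, d00, d01, d10, d11]

end PA

namespace PA
open SimpleGraph

variable {V : Type*} [Fintype V] [DecidableEq V]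

abbrev H (ω : Finset (Sym2 V)) : SimpleGraph V := SimpleGraph.fromEdgeSet (ω : Set (Sym2 V))

def R (ω : Finset (Sym2 V)) (x y : V) : Prop := (H ω).Reachable x y

lemma R_refl (ω : Finset (Sym2 V)) (x : V) : R ω x x := SimpleGraph.Reachable.refl _
lemma R_symm {ω : Finset (Sym2 V)} {x y : V} (h : R ω x y) : R ω y x := SimpleGraph.Reachable.symm h
lemma R_trans {ω : Finset (Sym2 V)} {x y z : V} (h : R ω x y) (h' : R ω y z) : R ω x z :=
  SimpleGraph.Reachable.trans h h'

lemma R_step {ω : Finset (Sym2 V)} {x y : V} (h : s(x, y) ∈ ω) : R ω x y := by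
  by_cases hxy : x = y
  · subst hxy; exact R_refl _ _
  · apply SimpleGraph.Adj.reachable
    rw [SimpleGraph.fromEdgeSet_adj]
    exact ⟨by exact_mod_cast h, hxy⟩

lemma R_ind {ω : Finset (Sym2 V)} {x y : V} (h : R ω x y) (P : V → Prop) (hx : P x)
    (hs : ∀ a b, P a → s(a, b) ∈ ω → P b) : P y := by
  unfold R at h
  rw [SimpleGraph.reachable_iff_reflTransGen] at h
  induction h with
  | refl => exact hx
  | tail _ hbc ih =>
    rw [SimpleGraph.fromEdgeSet_adj] at hbc
    exact hs _ _ ih (by exact_mod_cast hbc.1)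

lemma R_mono (x y : V) : Monotone (fun ω : Finset (Sym2 V) => R ω x y) := by
  intro ω ω' hω h
  exact R_ind h (fun z => R ω' x z) (R_refl _ _) fun a b ha hab => R_trans ha (R_step (hω hab))

lemma R_insert {ω : Finset (Sym2 V)} {u v x y : V} :
    R (insert s(u, v) ω) x y ↔ R (ω.erase s(u, v)) x y ∨
      (R (ω.erase s(u, v)) x u ∧ R (ω.erase s(u, v)) v y) ∨
      (R (ω.erase s(u, v)) x v ∧ R (ω.erase s(u, v)) u y) := by
  set ω' := ω.erase s(u, v) with hω'
  have hsub : ω' ⊆ insert s(u, v) ω :=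
    (Finset.erase_subset _ _).trans (Finset.subset_insert _ _)
  have huv : R (insert s(u, v) ω) u v := R_step (Finset.mem_insert_self _ _)
  constructor
  · intro h
    refine R_ind h (fun y => R ω' x y ∨ (R ω' x u ∧ R ω' v y) ∨ (R ω' x v ∧ R ω' u y))
      (Or.inl (R_refl _ _)) ?_
    intro a b ha hab
    by_cases he : s(a, b) = s(u, v)
    · rw [Sym2.eq_iff] at he
      rcases he with ⟨rfl, rfl⟩ | ⟨rfl, rfl⟩
      · rcases ha with h | ⟨h, h'⟩ | ⟨h, h'⟩
        · exact Or.inr (Or.inl ⟨h, R_refl _ _⟩)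
        · exact Or.inr (Or.inl ⟨h, R_refl _ _⟩)
        · exact Or.inl h
      · rcases ha with h | ⟨h, h'⟩ | ⟨h, h'⟩
        · exact Or.inr (Or.inr ⟨h, R_refl _ _⟩)
        · exact Or.inl h
        · exact Or.inr (Or.inr ⟨h, R_refl _ _⟩)
    · have hab' : R ω' a b := by
        apply R_step
        rw [hω', Finset.mem_erase]
        exact ⟨he, Finset.mem_of_mem_insert_of_ne hab he⟩
      rcases ha with h | ⟨h, h'⟩ | ⟨h, h'⟩
      · exact Or.inl (R_trans h hab')
      · exact Or.inr (Or.inl ⟨h, R_trans h' hab'⟩)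
      · exact Or.inr (Or.inr ⟨h, R_trans h' hab'⟩)
  · rintro (h | ⟨h, h'⟩ | ⟨h, h'⟩)
    · exact R_mono _ _ hsub h
    · exact R_trans (R_mono _ _ hsub h) (R_trans huv (R_mono _ _ hsub h'))
    · exact R_trans (R_mono _ _ hsub h) (R_trans (R_symm huv) (R_mono _ _ hsub h'))

def piv (x u v y : V) (ω : Finset (Sym2 V)) : Prop :=
  R (ω.erase s(u, v)) x u ∧ ¬ R (ω.erase s(u, v)) x v ∧ R (ω.erase s(u, v)) v y

lemma piv_diff (ω : Finset (Sym2 V)) (x u v y : V) :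
    ind (R (insert s(u, v) ω) x y) - ind (R (ω.erase s(u, v)) x y)
      = ind (piv x u v y ω) + ind (piv x v u y ω) := by
  rw [ind_congr R_insert]
  unfold piv
  rw [show s(v, u) = s(u, v) from Sym2.eq_swap]
  set ω' := ω.erase s(u, v)
  have h1 : R ω' x y → R ω' v y → R ω' x v := fun h h' => R_trans h (R_symm h')
  have h2 : R ω' x y → R ω' u y → R ω' x u := fun h h' => R_trans h (R_symm h')
  have h3 : R ω' x u → R ω' u y → R ω' x y := R_trans
  have h4 : R ω' x v → R ω' v y → R ω' x y := R_trans
  generalize R ω' x y = a1 at *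
  generalize R ω' v y = a2 at *
  generalize R ω' u y = a3 at *
  generalize R ω' x u = a4 at *
  generalize R ω' x v = a5 at *
  unfold ind
  by_cases a1 <;> by_cases a2 <;> by_cases a3 <;> by_cases a4 <;> by_cases a5 <;> simp_all

def cl (ω : Finset (Sym2 V)) (x : V) : Finset V := Finset.univ.filter (fun y => R ω x y)

lemma mem_cl {ω : Finset (Sym2 V)} {x y : V} : y ∈ cl ω x ↔ R ω x y := by simp [cl]

def T (A : Finset V) : Finset (Sym2 V) := Finset.univ.filter (fun e => ∃ z ∈ A, z ∈ e)

lemma mem_T {A : Finset V} {e : Sym2 V} : e ∈ T A ↔ ∃ z ∈ A, z ∈ e := by simp [T]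

lemma R_off {ω : Finset (Sym2 V)} {x v y : V} (hv : ¬ R ω x v) (h : R ω v y) :
    R (ω \ T (cl ω x)) v y := by
  have := R_ind h (fun z => R ω v z ∧ R (ω \ T (cl ω x)) v z) ⟨R_refl _ _, R_refl _ _⟩ (by
    rintro a b ⟨ha, ha'⟩ hab
    have hb : R ω v b := R_trans ha (R_step hab)
    refine ⟨hb, R_trans ha' (R_step ?_)⟩
    rw [Finset.mem_sdiff, mem_T]
    refine ⟨hab, ?_⟩
    rintro ⟨z, hz, hz'⟩
    rw [mem_cl] at hz
    rw [Sym2.mem_iff] at hz'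
    rcases hz' with rfl | rfl
    · exact hv (R_trans hz (R_symm ha))
    · exact hv (R_trans hz (R_symm hb)))
  exact this.2

lemma piv_sum (x u v y : V) (ω : Finset (Sym2 V)) :
    ind (piv x u v y ω) = ∑ A : Finset V,
      ind (cl (ω.erase s(u, v)) x = A ∧ u ∈ A ∧ v ∉ A) * ind (R (ω \ T A) v y) := by
  rw [Finset.sum_eq_single (cl (ω.erase s(u, v)) x)]
  · rw [← ind_and]
    apply ind_congr
    simp only [mem_cl, true_and]
    unfold piv
    constructor
    · rintro ⟨h1, h2, h3⟩
      refine ⟨⟨h1, h2⟩, ?_⟩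
      refine R_mono _ _ ?_ (R_off h2 h3)
      exact Finset.sdiff_subset_sdiff (Finset.erase_subset _ _) le_rfl
    · rintro ⟨⟨h1, h2⟩, h3⟩
      refine ⟨h1, h2, R_mono _ _ ?_ h3⟩
      intro e he
      rw [Finset.mem_sdiff, mem_T] at he
      rw [Finset.mem_erase]
      refine ⟨?_, he.1⟩
      rintro rfl
      exact he.2 ⟨u, mem_cl.2 h1, Sym2.mem_mk_left _ _⟩
  · intro A _ hA
    rw [ind_false, zero_mul]
    exact fun h => hA h.1.symm
  · simp

lemma cl_dep (ω : Finset (Sym2 V)) (x : V) (A : Finset V) : cl ω x = A ↔ cl (ω ∩ T A) x = A := by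
  have hsub : ω ∩ T A ⊆ ω := Finset.inter_subset_left
  constructor
  · rintro rfl
    ext y
    rw [mem_cl, mem_cl]
    refine ⟨fun h => R_mono _ _ hsub h, fun h => ?_⟩
    have := R_ind h (fun z => R ω x z ∧ R (ω ∩ T (cl ω x)) x z) ⟨R_refl _ _, R_refl _ _⟩ (by
      rintro a b ⟨ha, ha'⟩ hab
      refine ⟨R_trans ha (R_step hab), R_trans ha' (R_step ?_)⟩
      rw [Finset.mem_inter, mem_T]
      exact ⟨hab, a, mem_cl.2 ha, Sym2.mem_mk_left _ _⟩)
    exact this.2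
  · intro h
    have hA : ∀ y, y ∈ A ↔ R (ω ∩ T A) x y := fun y => by
      rw [← mem_cl, h]
    ext y
    rw [mem_cl]
    constructor
    · intro hy
      refine R_ind hy (fun z => z ∈ A) ((hA x).2 (R_refl _ _)) ?_
      intro a b ha hab
      rw [hA] at ha ⊢
      refine R_trans ha (R_step ?_)
      rw [Finset.mem_inter, mem_T]
      exact ⟨hab, a, (hA a).2 ha, Sym2.mem_mk_left _ _⟩
    · intro hy
      exact R_mono _ _ hsub ((hA y).1 hy)

lemma mem_of_edge {ω : Finset (Sym2 V)} {a b : V} (q : (H ω).Walk a b) {e : Sym2 V}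
    (he : e ∈ q.edges) : e ∈ ω := by
  have := q.edges_subset_edgeSet he
  rw [SimpleGraph.edgeSet_fromEdgeSet] at this
  exact_mod_cast this.1

lemma R_of_walk {ω ω' : Finset (Sym2 V)} {a b : V} (q : (H ω).Walk a b)
    (h : ∀ e ∈ q.edges, e ∈ ω') : R ω' a b := by
  refine ⟨q.transfer (H ω') ?_⟩
  intro e he
  have := q.edges_subset_edgeSet he
  rw [SimpleGraph.edgeSet_fromEdgeSet] at this ⊢
  exact ⟨by exact_mod_cast h e he, this.2⟩

lemma R_walk' {ω : Finset (Sym2 V)} {a b : V} (q : (H ω).Walk a b) : R q.edges.toFinset a b :=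
  R_of_walk q (fun _ h => List.mem_toFinset.2 h)

lemma sub_walk {ω : Finset (Sym2 V)} {a b : V} (q : (H ω).Walk a b) : q.edges.toFinset ⊆ ω :=
  fun _ h => mem_of_edge q (List.mem_toFinset.1 h)

lemma split_disj {ω : Finset (Sym2 V)} {a b z : V} (q : (H ω).Walk a b) (hq : q.IsPath)
    (hz : z ∈ q.support) :
    Disjoint (q.takeUntil z hz).edges.toFinset (q.dropUntil z hz).edges.toFinset := by
  have h := hq.isTrail.edges_nodup
  rw [← q.take_spec hz, SimpleGraph.Walk.edges_append] at h
  have := List.disjoint_of_nodup_append h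
  rw [Finset.disjoint_left]
  intro e h1 h2
  exact this (List.mem_toFinset.1 h1) (List.mem_toFinset.1 h2)

lemma through {ω : Finset (Sym2 V)} {v y : V} (A : Finset V) (h : R ω v y) :
    R (ω \ T A) v y ∨ ∃ a ∈ A, Dj (fun ω => R ω v a) (fun ω => R ω a y) ω := by
  obtain ⟨q, hq⟩ := h.exists_isPath
  by_cases hA : ∃ a ∈ A, a ∈ q.support
  · right
    obtain ⟨a, ha, hz⟩ := hA
    exact ⟨a, ha, _, _, sub_walk (q.takeUntil a hz), sub_walk (q.dropUntil a hz),
      split_disj q hq hz, R_walk' _, R_walk' _⟩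
  · left
    refine R_of_walk q ?_
    intro e he
    rw [Finset.mem_sdiff, mem_T]
    refine ⟨mem_of_edge q he, ?_⟩
    rintro ⟨z, hz, hze⟩
    exact hA ⟨z, hz, q.mem_support_of_mem_edges he hze⟩

lemma first_hit {G : SimpleGraph V} (P : V → Prop) {a x : V} (q : G.Walk a x) (hx : P x) :
    ∃ z, P z ∧ ∃ q' : G.Walk a z, ∀ e ∈ q'.edges, ∃ b ∈ e, ¬ P b := by
  induction q with
  | nil => exact ⟨_, hx, SimpleGraph.Walk.nil, by simp⟩
  | @cons a b c hab q ih =>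
    by_cases ha : P a
    · exact ⟨a, ha, SimpleGraph.Walk.nil, by simp⟩
    · obtain ⟨z, hz, q', hq'⟩ := ih hx
      refine ⟨z, hz, SimpleGraph.Walk.cons hab q', ?_⟩
      intro e he
      rw [SimpleGraph.Walk.edges_cons, List.mem_cons] at he
      rcases he with rfl | he
      · exact ⟨a, Sym2.mem_mk_left _ _, ha⟩
      · exact hq' e he

lemma tree {ω : Finset (Sym2 V)} {x u a : V} (h : R ω x u) (h' : R ω x a) :
    ∃ z, Dj (fun ω => R ω x z) (Dj (fun ω => R ω z u) (fun ω => R ω z a)) ω := by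
  obtain ⟨q, hq⟩ := h.exists_isPath
  obtain ⟨d⟩ := h'.symm
  obtain ⟨z, hz, d', hd'⟩ := first_hit (fun z => z ∈ q.support) d q.start_mem_support
  have hdisj : ∀ e ∈ d'.edges, e ∉ q.edges := by
    intro e he heq
    obtain ⟨b, hb, hb'⟩ := hd' e he
    exact hb' (q.mem_support_of_mem_edges heq hb)
  have s1 := q.edges_takeUntil_subset_edges hz
  have s2 := q.edges_dropUntil_subset_edges hz
  refine ⟨z, (q.takeUntil z hz).edges.toFinset,
    (q.dropUntil z hz).edges.toFinset ∪ d'.edges.toFinset, sub_walk _,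
    Finset.union_subset (sub_walk _) (sub_walk _), ?_, R_walk' _,
    (q.dropUntil z hz).edges.toFinset, d'.edges.toFinset, Finset.subset_union_left,
    Finset.subset_union_right, ?_, R_walk' _, R_symm (R_walk' _)⟩
  · rw [Finset.disjoint_union_right]
    refine ⟨split_disj q hq hz, ?_⟩
    rw [Finset.disjoint_left]
    intro e h1 h2
    exact hdisj e (List.mem_toFinset.1 h2) (s1 (List.mem_toFinset.1 h1))
  · rw [Finset.disjoint_left]
    intro e h1 h2
    exact hdisj e (List.mem_toFinset.1 h2) (s2 (List.mem_toFinset.1 h1))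

/-! probabilistic estimates -/

def tu (p : ℝ) (S : Finset (Sym2 V)) (x y : V) : ℝ := Ex p S (fun ω => ind (R ω x y))

lemma tu_symm (p : ℝ) (S : Finset (Sym2 V)) (x y : V) : tu p S x y = tu p S y x := by
  unfold tu
  congr 1
  funext ω
  exact ind_congr ⟨R_symm, R_symm⟩

lemma tu_self (p : ℝ) (S : Finset (Sym2 V)) (x : V) : tu p S x x = 1 := by
  unfold tu
  simp only [ind_true (R_refl _ x)]
  exact Ex_one p S

lemma piv_eq (p : ℝ) (S : Finset (Sym2 V)) (x u v y : V) :
    Ex p S (fun ω => ind (piv x u v y ω)) = ∑ A : Finset V,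
      Ex p S (fun ω => ind (cl (ω.erase s(u, v)) x = A ∧ u ∈ A ∧ v ∉ A)) *
        Ex p S (fun ω => ind (R (ω \ T A) v y)) := by
  simp only [piv_sum]
  rw [Ex_sum]
  apply Finset.sum_congr rfl
  intro A _
  apply Ex_indep p S (T A)
  · intro ω
    apply ind_congr
    rw [cl_dep, Finset.erase_inter, cl_dep ((ω ∩ T A).erase s(u, v)), Finset.erase_inter,
      Finset.inter_assoc, Finset.inter_self]
  · intro ω
    simp


lemma tu_nonneg {p : ℝ} (h0 : 0 ≤ p) (h1 : p ≤ 1) (S : Finset (Sym2 V))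
    (x y : V) : 0 ≤ tu p S x y := Ex_nonneg h0 h1 S fun _ => ind_nonneg _

lemma piv_upper {p : ℝ} (h0 : 0 ≤ p) (h1 : p ≤ 1) (S : Finset (Sym2 V))
    (x u v y : V) :
    Ex p S (fun ω => ind (piv x u v y ω)) ≤ tu p S x u * tu p S v y := by
  rw [piv_eq]
  calc _ ≤ ∑ A : Finset V, Ex p S (fun ω => ind (cl (ω.erase s(u, v)) x = A ∧ u ∈ A ∧ v ∉ A)) *
        tu p S v y := by
        apply Finset.sum_le_sum
        intro A _
        apply mul_le_mul_of_nonneg_left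
        · apply Ex_mono h0 h1
          intro ω _
          exact ind_le (fun h => R_mono _ _ Finset.sdiff_subset h)
        · exact Ex_nonneg h0 h1 S fun _ => ind_nonneg _
    _ ≤ _ := by
        rw [← Finset.sum_mul, ← Ex_sum]
        apply mul_le_mul_of_nonneg_right _ (tu_nonneg h0 h1 S v y)
        apply Ex_mono h0 h1
        intro ω _
        rw [Finset.sum_eq_single (cl (ω.erase s(u, v)) x)]
        · apply ind_le
          rintro ⟨_, h, _⟩
          exact R_mono _ _ (Finset.erase_subset _ _) (mem_cl.1 h)
        · intro A _ hA
          exact ind_false (fun h => hA h.1.symm)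
        · simp

lemma off_lower {p : ℝ} (h0 : 0 ≤ p) (h1 : p ≤ 1) (S : Finset (Sym2 V))
    (A : Finset V) (v y : V) :
    tu p S v y - ∑ a ∈ A, tu p S v a * tu p S a y ≤ Ex p S (fun ω => ind (R (ω \ T A) v y)) := by
  have key : tu p S v y ≤ Ex p S (fun ω => ind (R (ω \ T A) v y)) +
      ∑ a ∈ A, Ex p S (fun ω => ind (Dj (fun ω => R ω v a) (fun ω => R ω a y) ω)) := by
    rw [← Ex_sum, ← Ex_add]
    apply Ex_mono h0 h1
    intro ω _
    have hs : ∀ a ∈ A, 0 ≤ ind (Dj (fun ω => R ω v a) (fun ω => R ω a y) ω) :=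
      fun a _ => ind_nonneg _
    by_cases h : R ω v y
    · rw [ind_true h]
      rcases through A h with h' | ⟨a, ha, h'⟩
      · rw [ind_true h']
        linarith [Finset.sum_nonneg hs]
      · have := Finset.single_le_sum hs ha
        rw [ind_true h'] at this
        linarith [ind_nonneg (R (ω \ T A) v y)]
    · rw [ind_false h]
      linarith [Finset.sum_nonneg hs, ind_nonneg (R (ω \ T A) v y)]
  have : ∑ a ∈ A, Ex p S (fun ω => ind (Dj (fun ω => R ω v a) (fun ω => R ω a y) ω)) ≤
      ∑ a ∈ A, tu p S v a * tu p S a y := by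
    apply Finset.sum_le_sum
    intro a _
    exact bk h0 h1 S _ _ (R_mono _ _) (R_mono _ _)
  linarith

lemma tree_bound {p : ℝ} (h0 : 0 ≤ p) (h1 : p ≤ 1) (S : Finset (Sym2 V))
    (x u a : V) : Ex p S (fun ω => ind (R ω x u) * ind (R ω x a)) ≤
    ∑ z, tu p S x z * (tu p S z u * tu p S z a) := by
  have key : Ex p S (fun ω => ind (R ω x u) * ind (R ω x a)) ≤
      ∑ z, Ex p S (fun ω => ind (Dj (fun ω => R ω x z)
        (Dj (fun ω => R ω z u) (fun ω => R ω z a)) ω)) := by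
    rw [← Ex_sum]
    apply Ex_mono h0 h1
    intro ω _
    rw [← ind_and]
    have hs : ∀ z ∈ (Finset.univ : Finset V), 0 ≤ ind (Dj (fun ω => R ω x z)
        (Dj (fun ω => R ω z u) (fun ω => R ω z a)) ω) :=
      fun a _ => ind_nonneg _
    by_cases h : R ω x u ∧ R ω x a
    · rw [ind_true h]
      obtain ⟨z, hz⟩ := tree h.1 h.2
      have := Finset.single_le_sum hs (Finset.mem_univ z)
      rwa [ind_true hz] at this
    · rw [ind_false h]
      exact Finset.sum_nonneg hs
  refine key.trans (Finset.sum_le_sum fun z _ => ?_)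
  refine (bk h0 h1 S _ _ (R_mono _ _) (Dj_mono _ _)).trans ?_
  apply mul_le_mul_of_nonneg_left _ (tu_nonneg h0 h1 S x z)
  exact bk h0 h1 S _ _ (R_mono _ _) (R_mono _ _)

lemma piv_lower {p : ℝ} (h0 : 0 ≤ p) (h1 : p ≤ 1) (S : Finset (Sym2 V))
    (x u v y : V) :
    tu p S x u * tu p S v y -
      ∑ a, (∑ z, tu p S x z * (tu p S z u * tu p S z a)) * (tu p S v a * tu p S a y)
      ≤ Ex p S (fun ω => ind (piv x u v y ω)) := by
  have hB : ∀ a, 0 ≤ tu p S v a * tu p S a y := fun a =>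
    mul_nonneg (tu_nonneg h0 h1 S _ _) (tu_nonneg h0 h1 S _ _)
  have s1 : ∑ A : Finset V, Ex p S (fun ω => ind (cl (ω.erase s(u, v)) x = A ∧ R ω x u)) *
      (tu p S v y - ∑ a ∈ A, tu p S v a * tu p S a y) ≤
      Ex p S (fun ω => ind (piv x u v y ω)) := by
    rw [piv_eq]
    apply Finset.sum_le_sum
    intro A _
    by_cases hv : v ∈ A
    · have e1 : Ex p S (fun ω => ind (cl (ω.erase s(u, v)) x = A ∧ u ∈ A ∧ v ∉ A)) = 0 := by
        rw [Ex_congr p S (g := fun _ => 0)]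
        · simp [Ex]
        · intro ω _
          exact ind_false (fun h => h.2.2 hv)
      rw [e1, zero_mul]
      apply mul_nonpos_of_nonneg_of_nonpos
      · exact Ex_nonneg h0 h1 S fun _ => ind_nonneg _
      · have := Finset.single_le_sum (fun a _ => hB a) hv
        rw [tu_self, one_mul] at this
        linarith
    · have e1 : Ex p S (fun ω => ind (cl (ω.erase s(u, v)) x = A ∧ R ω x u)) =
          Ex p S (fun ω => ind (cl (ω.erase s(u, v)) x = A ∧ u ∈ A ∧ v ∉ A)) := by
        apply Ex_congr
        intro ω _
        apply ind_congr
        constructor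
        · rintro ⟨rfl, h⟩
          refine ⟨rfl, ?_, hv⟩
          have h' : R (insert s(u, v) ω) x u := R_mono _ _ (Finset.subset_insert _ _) h
          rw [R_insert] at h'
          rw [mem_cl] at hv ⊢
          tauto
        · rintro ⟨rfl, h, _⟩
          exact ⟨rfl, R_mono _ _ (Finset.erase_subset _ _) (mem_cl.1 h)⟩
      rw [e1]
      exact mul_le_mul_of_nonneg_left (off_lower h0 h1 S A v y)
        (Ex_nonneg h0 h1 S fun _ => ind_nonneg _)
  have s2 : Ex p S (fun ω => ind (R ω x u) * tu p S v y -
        ∑ a, ind (R ω x u) * ind (R ω x a) * (tu p S v a * tu p S a y)) ≤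
      ∑ A : Finset V, Ex p S (fun ω => ind (cl (ω.erase s(u, v)) x = A ∧ R ω x u)) *
      (tu p S v y - ∑ a ∈ A, tu p S v a * tu p S a y) := by
    simp only [← Ex_mul_const]
    rw [← Ex_sum]
    apply Ex_mono h0 h1
    intro ω _
    rw [Finset.sum_eq_single (cl (ω.erase s(u, v)) x)]
    · by_cases h : R ω x u
      · rw [ind_true h, ind_true ⟨rfl, h⟩]
        simp only [one_mul]
        apply sub_le_sub_left
        have : ∑ a ∈ cl (ω.erase s(u, v)) x, tu p S v a * tu p S a y =
            ∑ a ∈ cl (ω.erase s(u, v)) x, ind (R ω x a) * (tu p S v a * tu p S a y) := by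
          apply Finset.sum_congr rfl
          intro a ha
          rw [ind_true (R_mono _ _ (Finset.erase_subset _ _) (mem_cl.1 ha)), one_mul]
        rw [this]
        apply Finset.sum_le_sum_of_subset_of_nonneg (Finset.subset_univ _)
        intro a _ _
        exact mul_nonneg (ind_nonneg _) (hB a)
      · rw [ind_false h, ind_false (fun h' => h h'.2)]
        simp
    · intro A _ hA
      rw [ind_false (fun h => hA h.1.symm), zero_mul]
    · simp
  rw [Ex_sub, Ex_mul_const, Ex_sum] at s2
  have s3 : ∑ a, Ex p S (fun ω => ind (R ω x u) * ind (R ω x a) * (tu p S v a * tu p S a y)) ≤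
      ∑ a, (∑ z, tu p S x z * (tu p S z u * tu p S z a)) * (tu p S v a * tu p S a y) := by
    apply Finset.sum_le_sum
    intro a _
    rw [Ex_mul_const]
    exact mul_le_mul_of_nonneg_right (tree_bound h0 h1 S x u a) (hB a)
  have : Ex p S (fun ω => ind (R ω x u)) = tu p S x u := rfl
  rw [this] at s2
  linarith

end PA

namespace PA
open Percolation

variable {V : Type*} [Fintype V] [DecidableEq V]

def ES (G : SimpleGraph V) : Finset (Sym2 V) := Finset.univ.filter (fun e => e ∈ G.edgeSet)

lemma mem_ES {G : SimpleGraph V} {e : Sym2 V} : e ∈ ES G ↔ e ∈ G.edgeSet := by simp [ES]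

def toFin (G : SimpleGraph V) (ω : Config G) : Finset (Sym2 V) :=
  Finset.univ.filter (fun e => ∃ h : e ∈ G.edgeSet, ω ⟨e, h⟩ = true)

lemma mem_toFin {G : SimpleGraph V} {ω : Config G} {e : Sym2 V} :
    e ∈ toFin G ω ↔ ∃ h : e ∈ G.edgeSet, ω ⟨e, h⟩ = true := by simp [toFin]

lemma occupied_eq (G : SimpleGraph V) (ω : Config G) : occupied G ω = H (toFin G ω) := by
  unfold occupied H
  congr 1
  ext e
  simp [mem_toFin]

lemma weight_eq (G : SimpleGraph V) (p : ℝ) (ω : Config G) :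
    weight G p ω = w p (ES G) (toFin G ω) := by
  unfold weight w
  rw [Finset.prod_subtype (ES G) (fun e => mem_ES)]
  apply Finset.prod_congr rfl
  rintro ⟨e, he⟩ _
  have : (e ∈ toFin G ω) ↔ ω ⟨e, he⟩ = true := by
    rw [mem_toFin]
    exact ⟨fun ⟨_, h⟩ => h, fun h => ⟨he, h⟩⟩
  simp only [this]

def toCfg (G : SimpleGraph V) (ω : Finset (Sym2 V)) : Config G := fun e => decide (e.1 ∈ ω)

lemma toCfg_apply (G : SimpleGraph V) (ω : Finset (Sym2 V)) (e : G.edgeSet) :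
    toCfg G ω e = true ↔ e.1 ∈ ω := by
  unfold toCfg
  exact decide_eq_true_iff

lemma expect_eq (G : SimpleGraph V) (p : ℝ) (F : Finset (Sym2 V) → ℝ) :
    expect G p (fun ω => F (toFin G ω)) = Ex p (ES G) F := by
  unfold expect Ex
  refine Finset.sum_bij' (fun ω _ => toFin G ω)
    (fun ω _ => toCfg G ω) ?_ ?_ ?_ ?_ ?_
  · intro ω _
    rw [Finset.mem_powerset]
    intro e he
    obtain ⟨h, _⟩ := mem_toFin.1 he
    exact mem_ES.2 h
  · intro ω _
    exact Finset.mem_univ _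
  · intro ω _
    funext e
    have : (e.1 ∈ toFin G ω) ↔ ω e = true := by
      rw [mem_toFin]
      exact ⟨fun ⟨_, h⟩ => h, fun h => ⟨e.2, h⟩⟩
    rw [Bool.eq_iff_iff, toCfg_apply, this]
  · intro ω hω
    ext e
    rw [mem_toFin]
    rw [Finset.mem_powerset] at hω
    constructor
    · rintro ⟨_, h⟩
      exact (toCfg_apply G ω _).1 h
    · intro h
      exact ⟨mem_ES.1 (hω h), (toCfg_apply G ω _).2 h⟩
  · intro ω _
    rw [weight_eq]

lemma tau_eq (G : SimpleGraph V) (p : ℝ) (x y : V) : tau G p x y = tu p (ES G) x y := by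
  unfold tu
  rw [← expect_eq]
  unfold tau prob expect
  apply Finset.sum_congr rfl
  intro ω _
  unfold ind R
  simp only [occupied_eq]
  simp

lemma chi_eq' (G : SimpleGraph V) (p : ℝ) (x : V) :
    chi G x p = Ex p (ES G) (fun ω => ∑ y, ind (R ω x y)) := by
  rw [← expect_eq]
  unfold chi
  congr 1
  funext ω
  unfold cluster ind R
  rw [occupied_eq, Finset.card_filter]
  push_cast
  apply Finset.sum_congr rfl
  intro y _
  congr

lemma chi_eq (G : SimpleGraph V) (p : ℝ) (x : V) : chi G x p = ∑ y, tu p (ES G) x y := by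
  rw [chi_eq', Ex_sum]
  rfl

def Dt (G : SimpleGraph V) : Finset (V × V) := Finset.univ.filter (fun q => G.Adj q.1 q.2)

lemma mem_Dt {G : SimpleGraph V} {q : V × V} : q ∈ Dt G ↔ G.Adj q.1 q.2 := by simp [Dt]

lemma sum_darts (G : SimpleGraph V) (F : V → V → ℝ) (g : Sym2 V → ℝ)
    (h : ∀ u v, G.Adj u v → g s(u, v) = F u v + F v u) :
    ∑ e ∈ ES G, g e = ∑ q ∈ Dt G, F q.1 q.2 := by
  rw [← Finset.sum_fiberwise_of_maps_to (s := Dt G) (t := ES G) (g := fun q => s(q.1, q.2))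
    (fun q hq => mem_ES.2 (mem_Dt.1 hq))]
  apply Finset.sum_congr rfl
  intro e he
  induction e using Sym2.ind with
  | _ u v =>
    have huv : G.Adj u v := mem_ES.1 he
    rw [h u v huv]
    have : (Dt G).filter (fun q => s(q.1, q.2) = s(u, v)) = {(u, v), (v, u)} := by
      ext ⟨a, b⟩
      simp only [Finset.mem_filter, mem_Dt, Finset.mem_insert, Finset.mem_singleton,
        Prod.mk.injEq, Sym2.eq_iff]
      constructor
      · exact fun h => h.2
      · rintro (⟨rfl, rfl⟩ | ⟨rfl, rfl⟩)
        · exact ⟨huv, Or.inl ⟨rfl, rfl⟩⟩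
        · exact ⟨huv.symm, Or.inr ⟨rfl, rfl⟩⟩
    rw [this, Finset.sum_pair]
    intro hh
    exact huv.ne (Prod.mk.inj hh).1

lemma chi_deriv (G : SimpleGraph V) (p : ℝ) (x : V) :
    deriv (chi G x) p = ∑ y, ∑ q ∈ Dt G, Ex p (ES G) (fun ω => ind (piv x q.1 q.2 y ω)) := by
  have h : chi G x = fun p => Ex p (ES G) (fun ω => ∑ y, ind (R ω x y)) := by
    funext p
    exact chi_eq' G p x
  rw [h, (Ex_russo p (ES G) _).deriv, Finset.sum_comm]
  apply sum_darts G (fun u v => ∑ y, Ex p (ES G) (fun ω => ind (piv x u v y ω)))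
  intro u v _
  simp only [← Ex_sum, ← Ex_add, ← Finset.sum_sub_distrib, piv_diff, Finset.sum_add_distrib]

/-! transitivity -/

lemma R_img (g : V → V) {ω : Finset (Sym2 V)} {x y : V} (h : R ω x y) :
    R (ω.image (Sym2.map g)) (g x) (g y) := by
  refine R_ind h (fun z => R (ω.image (Sym2.map g)) (g x) (g z)) (R_refl _ _) ?_
  intro a b ha hab
  refine R_trans ha (R_step ?_)
  rw [Finset.mem_image]
  exact ⟨_, hab, by simp⟩

lemma img_img (f g : V → V) (hfg : ∀ x, f (g x) = x) (ω : Finset (Sym2 V)) :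
    (ω.image (Sym2.map g)).image (Sym2.map f) = ω := by
  rw [Finset.image_image, ← Sym2.map_comp]
  have : f ∘ g = id := funext hfg
  rw [this, Sym2.map_id, Finset.image_id]

lemma img_ES (G : SimpleGraph V) (φ : G ≃g G) {e : Sym2 V} (he : e ∈ ES G) :
    Sym2.map φ e ∈ ES G := by
  rw [mem_ES] at *
  induction e using Sym2.ind with
  | _ u v => exact φ.map_adj_iff.2 he

lemma map_map' (f g : V → V) (hfg : ∀ x, f (g x) = x) (e : Sym2 V) :
    Sym2.map f (Sym2.map g e) = e := by
  rw [Sym2.map_map]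
  have : f ∘ g = id := funext hfg
  rw [this, Sym2.map_id, id]

lemma w_img (G : SimpleGraph V) (φ : G ≃g G) (p : ℝ) (ω : Finset (Sym2 V)) :
    w p (ES G) (ω.image (Sym2.map φ)) = w p (ES G) ω := by
  unfold w
  symm
  refine Finset.prod_bij' (fun e _ => Sym2.map φ e) (fun e _ => Sym2.map φ.symm e) ?_ ?_ ?_ ?_ ?_
  · intro e he
    exact img_ES G φ he
  · intro e he
    exact img_ES G φ.symm he
  · intro e _
    exact map_map' _ _ (fun x => φ.symm_apply_apply x) e
  · intro e _
    exact map_map' _ _ (fun x => φ.apply_symm_apply x) e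
  · intro e _
    have : Sym2.map φ e ∈ ω.image (Sym2.map φ) ↔ e ∈ ω := by
      rw [Finset.mem_image]
      constructor
      · rintro ⟨e', he', h⟩
        rwa [← Sym2.map.injective φ.injective h]
      · intro h
        exact ⟨e, h, rfl⟩
    simp only [this]

lemma Ex_img (G : SimpleGraph V) (φ : G ≃g G) (p : ℝ) (f : Finset (Sym2 V) → ℝ) :
    Ex p (ES G) (fun ω => f (ω.image (Sym2.map φ))) = Ex p (ES G) f := by
  unfold Ex
  refine Finset.sum_bij' (fun ω _ => ω.image (Sym2.map φ)) (fun ω _ => ω.image (Sym2.map φ.symm))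
    ?_ ?_ ?_ ?_ ?_
  · intro ω hω
    rw [Finset.mem_powerset] at *
    intro e he
    obtain ⟨e', he', rfl⟩ := Finset.mem_image.1 he
    exact img_ES G φ (hω he')
  · intro ω hω
    rw [Finset.mem_powerset] at *
    intro e he
    obtain ⟨e', he', rfl⟩ := Finset.mem_image.1 he
    exact img_ES G φ.symm (hω he')
  · intro ω _
    exact img_img _ _ (fun x => φ.symm_apply_apply x) ω
  · intro ω _
    exact img_img _ _ (fun x => φ.apply_symm_apply x) ω
  · intro ω _
    rw [w_img]

lemma tu_img (G : SimpleGraph V) (φ : G ≃g G) (p : ℝ) (x y : V) :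
    tu p (ES G) (φ x) (φ y) = tu p (ES G) x y := by
  unfold tu
  rw [← Ex_img G φ]
  congr 1
  funext ω
  apply ind_congr
  constructor
  · intro h
    have := R_img φ.symm h
    rwa [img_img _ _ (fun x => φ.symm_apply_apply x), φ.symm_apply_apply, φ.symm_apply_apply] at this
  · exact R_img φ

lemma chi_const (G : SimpleGraph V) (ht : IsTransitive G) (p : ℝ) (x y : V) :
    chi G x p = chi G y p := by
  obtain ⟨φ, rfl⟩ := ht x y
  rw [chi_eq, chi_eq, ← Equiv.sum_comp φ.toEquiv (fun z => tu p (ES G) (φ x) z)]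
  apply Finset.sum_congr rfl
  intro z _
  exact (tu_img G φ p x z).symm

lemma chi_poly (G : SimpleGraph V) (x : V) :
    ∃ q : Polynomial ℝ, ∀ p : ℝ, chi G x p = q.eval p := by
  refine ⟨∑ ω : Config G, (∏ e : G.edgeSet, if ω e then Polynomial.X else 1 - Polynomial.X) *
    Polynomial.C ((cluster G ω x).card : ℝ), ?_⟩
  intro p
  unfold chi expect weight
  rw [Polynomial.eval_finsetSum]
  apply Finset.sum_congr rfl
  intro ω _
  rw [Polynomial.eval_mul, Polynomial.eval_prod, Polynomial.eval_C]
  congr 1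
  apply Finset.prod_congr rfl
  intro e _
  split_ifs <;> simp

lemma sum_Dt (G : SimpleGraph V) [DecidableRel G.Adj] (Ω : ℕ) (hreg : G.IsRegularOfDegree Ω)
    (h : V → ℝ) : ∑ q ∈ Dt G, h q.1 = (Ω : ℝ) * ∑ u, h u := by
  unfold Dt
  rw [Finset.sum_filter, Fintype.sum_prod_type, Finset.mul_sum]
  apply Finset.sum_congr rfl
  intro u _
  trans (∑ y, if G.Adj u y then h u else 0)
  · apply Finset.sum_congr rfl
    intro y _
    congr
  rw [← Finset.sum_filter, Finset.sum_const, nsmul_eq_mul, ← hreg u,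
    ← SimpleGraph.card_neighborFinset_eq_degree, SimpleGraph.neighborFinset_eq_filter]

lemma triangle_le (G : SimpleGraph V) (p : ℝ) {u v : V} (h : G.Adj u v) :
    triangle G p u v ≤ nablaBar G p := by
  apply le_csSup
  · apply Set.Finite.bddAbove
    apply (Set.finite_range (fun q : V × V => triangle G p q.1 q.2)).subset
    rintro t ⟨x, y, _, rfl⟩
    exact ⟨(x, y), rfl⟩
  · exact ⟨u, v, h, rfl⟩

end PA

open Percolation in
/-- Proposition A.1: the susceptibility is a polynomial in `p`, and its
derivative satisfies the Aizenman–Newman differential inequality. -/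
theorem susceptibility_differential_inequality
    {V : Type*} [Fintype V] [DecidableEq V]
    (G : SimpleGraph V) [DecidableRel G.Adj]
    (hconn : G.Connected) (htrans : IsTransitive G)
    (Ω : ℕ) (hreg : G.IsRegularOfDegree Ω)
    (x₀ : V) :
    (∃ q : Polynomial ℝ, ∀ p : ℝ, chi G x₀ p = q.eval p) ∧
      ∀ p : ℝ, 0 < p → p < 1 →
        (1 - nablaBar G p) * (Ω : ℝ) * chi G x₀ p ^ 2 ≤ deriv (chi G x₀) p ∧
          deriv (chi G x₀) p ≤ (Ω : ℝ) * chi G x₀ p ^ 2 := by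
  refine ⟨PA.chi_poly G x₀, ?_⟩
  intro p hp0 hp1
  have h0 := hp0.le
  have h1 := hp1.le
  set c := chi G x₀ p with hc
  set t := PA.tu p (PA.ES G) with ht
  have hrow : ∀ x, ∑ y, t x y = c := by
    intro x
    rw [hc, PA.chi_const G htrans p x₀ x, PA.chi_eq]
  have hcol : ∀ y, ∑ x, t x y = c := by
    intro y
    rw [← hrow y]
    exact Finset.sum_congr rfl fun x _ => PA.tu_symm _ _ _ _
  constructor
  · have hV : (0 : ℝ) < Fintype.card V := by
      have : Nonempty V := ⟨x₀⟩
      exact_mod_cast Fintype.card_pos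
    have hD : ∑ x : V, deriv (chi G x) p = Fintype.card V * deriv (chi G x₀) p := by
      have : ∀ x, chi G x = chi G x₀ := fun x => funext fun p => PA.chi_const G htrans p x x₀
      simp [this]
    have hL : ∑ x : V, ∑ y : V, ∑ q ∈ PA.Dt G, (t x q.1 * t q.2 y -
        ∑ a, (∑ z, t x z * (t z q.1 * t z a)) * (t q.2 a * t a y)) ≤
        ∑ x : V, deriv (chi G x) p := by
      apply Finset.sum_le_sum
      intro x _
      rw [PA.chi_deriv]
      apply Finset.sum_le_sum
      intro y _
      apply Finset.sum_le_sum
      intro q _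
      exact PA.piv_lower h0 h1 (PA.ES G) x q.1 q.2 y
    have hE : ∑ x : V, ∑ y : V, ∑ q ∈ PA.Dt G, (t x q.1 * t q.2 y -
        ∑ a, (∑ z, t x z * (t z q.1 * t z a)) * (t q.2 a * t a y)) =
        ∑ q ∈ PA.Dt G, (c ^ 2 - c ^ 2 * triangle G p q.1 q.2) := by
      have hsw : ∀ F : V → V → V × V → ℝ, ∑ x : V, ∑ y : V, ∑ q ∈ PA.Dt G, F x y q =
          ∑ q ∈ PA.Dt G, ∑ x : V, ∑ y : V, F x y q := by
        intro F
        rw [Finset.sum_comm]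
        have : ∀ y, ∑ x : V, ∑ q ∈ PA.Dt G, F x y q = ∑ q ∈ PA.Dt G, ∑ x : V, F x y q :=
          fun y => Finset.sum_comm
        simp only [this]
        rw [Finset.sum_comm]
        exact Finset.sum_congr rfl fun q _ => Finset.sum_comm
      rw [hsw]
      apply Finset.sum_congr rfl
      intro q _
      simp only [Finset.sum_sub_distrib]
      congr 1
      · simp only [← Finset.mul_sum, hrow, ← Finset.sum_mul, hcol]
        ring
      · have e1 : ∀ x, ∑ y, ∑ a, (∑ z, t x z * (t z q.1 * t z a)) * (t q.2 a * t a y) =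
            ∑ a, (∑ z, t x z * (t z q.1 * t z a)) * (t q.2 a * c) := by
          intro x
          rw [Finset.sum_comm]
          apply Finset.sum_congr rfl
          intro a _
          rw [← Finset.mul_sum, ← Finset.mul_sum, hrow]
        simp only [e1]
        rw [Finset.sum_comm]
        have e2 : ∀ a, ∑ x, (∑ z, t x z * (t z q.1 * t z a)) * (t q.2 a * c) =
            (∑ z, c * (t z q.1 * t z a)) * (t q.2 a * c) := by
          intro a
          rw [← Finset.sum_mul, Finset.sum_comm]
          simp only [← Finset.sum_mul, hcol]
        simp only [e2]
        unfold triangle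
        simp only [PA.tau_eq]
        rw [Finset.sum_comm, Finset.mul_sum]
        apply Finset.sum_congr rfl
        intro a _
        rw [Finset.sum_mul, Finset.mul_sum]
        apply Finset.sum_congr rfl
        intro z _
        rw [show PA.tu p (PA.ES G) q.1 z = t z q.1 from PA.tu_symm _ _ _ _,
          show PA.tu p (PA.ES G) a q.2 = t q.2 a from PA.tu_symm _ _ _ _]
        ring
    have hF : ∑ q ∈ PA.Dt G, (c ^ 2 - c ^ 2 * nablaBar G p) ≤
        ∑ q ∈ PA.Dt G, (c ^ 2 - c ^ 2 * triangle G p q.1 q.2) := by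
      apply Finset.sum_le_sum
      intro q hq
      apply sub_le_sub_left
      exact mul_le_mul_of_nonneg_left (PA.triangle_le G p (PA.mem_Dt.1 hq)) (sq_nonneg c)
    have hS := PA.sum_Dt G Ω hreg (fun _ => c ^ 2 - c ^ 2 * nablaBar G p)
    rw [Finset.sum_const (s := Finset.univ), Finset.card_univ, nsmul_eq_mul] at hS
    rw [hS] at hF
    rw [← hE] at hF
    have := hF.trans hL
    rw [hD] at this
    apply le_of_mul_le_mul_left _ hV
    linarith
  · rw [PA.chi_deriv]
    calc _ ≤ ∑ y : V, ∑ q ∈ PA.Dt G, t x₀ q.1 * t q.2 y := by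
          apply Finset.sum_le_sum
          intro y _
          apply Finset.sum_le_sum
          intro q _
          exact PA.piv_upper h0 h1 (PA.ES G) x₀ q.1 q.2 y
      _ = (Ω : ℝ) * c ^ 2 := by
          rw [Finset.sum_comm]
          simp only [← Finset.mul_sum, hrow]
          rw [PA.sum_Dt G Ω hreg (fun u => t x₀ u * c), ← Finset.sum_mul, hrow]
          ring
end
end

section
/- Let 𝔾 be a finite connected transitive graph, let 0 < p < 1 and 0 < γ < 1, and set K = 1 + Ωp/(1−p). Then the magnetization satisfies M(p,γ) ≥ (1/(2K))·[√(4Kγ + χ(p)^{-2}) − χ(p)^{-1}], and in particular M(p,γ) ≥ ((√(4K+1) − 1)/(2K))·min{√γ, γχ(p)}. -/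
noncomputable section
open Classical

namespace Percolation
section Helpers

set_option linter.unusedSectionVars false

variable {V : Type*} [Fintype V] [DecidableEq V]

/-- Bernoulli weight of one bond. -/
def bw (p : ℝ) (b : Bool) : ℝ := if b then p else 1 - p

theorem sum_bw (p : ℝ) : ∑ b : Bool, bw p b = 1 := by
  simp [bw]

theorem sum_prod_bw {ι : Type*} [Fintype ι] [DecidableEq ι] (p : ℝ) :
    ∑ ω : ι → Bool, ∏ i, bw p (ω i) = 1 := by
  have h := Finset.prod_univ_sum (fun _ : ι => (Finset.univ : Finset Bool)) (fun _ b => bw p b)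
  rw [Fintype.piFinset_univ] at h
  rw [← h]
  simp [bw]

theorem indep_aux {ι : Type*} [Fintype ι] [DecidableEq ι] (p : ℝ) (P : ι → Prop)
    (f g : (ι → Bool) → ℝ)
    (hf : ∀ ω ω' : ι → Bool, (∀ i, P i → ω i = ω' i) → f ω = f ω')
    (hg : ∀ ω ω' : ι → Bool, (∀ i, ¬ P i → ω i = ω' i) → g ω = g ω') :
    ∑ ω : ι → Bool, (∏ i, bw p (ω i)) * (f ω * g ω) =
      (∑ ω : ι → Bool, (∏ i, bw p (ω i)) * f ω) * (∑ ω : ι → Bool, (∏ i, bw p (ω i)) * g ω) := by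
  let e := (Equiv.piEquivPiSubtypeProd P (fun _ : ι => Bool)).symm
  let d1 : {i // P i} → Bool := fun _ => true
  let d2 : {i // ¬ P i} → Bool := fun _ => true
  have hw : ∀ a b, (∏ i, bw p (e (a, b) i)) = (∏ i, bw p (a i)) * (∏ i, bw p (b i)) := by
    intro a b
    rw [← Fintype.prod_subtype_mul_prod_subtype P]
    congr 1
    · refine Finset.prod_congr rfl fun i _ => ?_
      simp [e, Equiv.piEquivPiSubtypeProd, i.2]
    · refine Finset.prod_congr rfl fun i _ => ?_
      simp [e, Equiv.piEquivPiSubtypeProd, i.2]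
  have hf' : ∀ a b, f (e (a, b)) = f (e (a, d2)) := by
    intro a b
    refine hf _ _ fun i hi => ?_
    simp [e, Equiv.piEquivPiSubtypeProd, hi]
  have hg' : ∀ a b, g (e (a, b)) = g (e (d1, b)) := by
    intro a b
    refine hg _ _ fun i hi => ?_
    simp [e, Equiv.piEquivPiSubtypeProd, hi]
  have key : ∀ F : (ι → Bool) → ℝ, ∑ ω : ι → Bool, F ω = ∑ a, ∑ b, F (e (a, b)) := by
    intro F
    rw [← Fintype.sum_prod_type']
    exact (Equiv.sum_comp e F).symm
  have hA : ∑ ω : ι → Bool, (∏ i, bw p (ω i)) * f ω =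
      ∑ a : {i // P i} → Bool, (∏ i, bw p (a i)) * f (e (a, d2)) := by
    rw [key]
    refine Finset.sum_congr rfl fun a _ => ?_
    calc _ = ∑ b : {i // ¬ P i} → Bool, ((∏ i, bw p (a i)) * f (e (a, d2))) * (∏ i, bw p (b i)) := by
          refine Finset.sum_congr rfl fun b _ => ?_
          rw [hw, hf']; ring
      _ = _ := by rw [← Finset.mul_sum, sum_prod_bw, mul_one]
  have hB : ∑ ω : ι → Bool, (∏ i, bw p (ω i)) * g ω =
      ∑ b : {i // ¬ P i} → Bool, (∏ i, bw p (b i)) * g (e (d1, b)) := by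
    rw [key, Finset.sum_comm]
    refine Finset.sum_congr rfl fun b _ => ?_
    calc _ = ∑ a : {i // P i} → Bool, ((∏ i, bw p (b i)) * g (e (d1, b))) * (∏ i, bw p (a i)) := by
          refine Finset.sum_congr rfl fun a _ => ?_
          rw [hw, hg']; ring
      _ = _ := by rw [← Finset.mul_sum, sum_prod_bw, mul_one]
  rw [hA, hB, Finset.sum_mul_sum, key]
  refine Finset.sum_congr rfl fun a _ => Finset.sum_congr rfl fun b _ => ?_
  rw [hw, hf', hg']; ring

/-- `f` depends only on the bonds in `S`. -/
def Dep (G : SimpleGraph V) {β : Type*} (f : Config G → β) (S : Set (Sym2 V)) : Prop :=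
  ∀ ω ω' : Config G, (∀ e : G.edgeSet, e.1 ∈ S → ω e = ω' e) → f ω = f ω'

theorem weight_eq (G : SimpleGraph V) (p : ℝ) (ω : Config G) :
    weight G p ω = ∏ e : G.edgeSet, bw p (ω e) := rfl

theorem expect_indep (G : SimpleGraph V) (p : ℝ) (f g : Config G → ℝ) (S T : Set (Sym2 V))
    (hf : Dep G f S) (hg : Dep G g T) (hST : ∀ e, e ∈ S → e ∉ T) :
    expect G p (fun ω => f ω * g ω) = expect G p f * expect G p g := by
  refine indep_aux (ι := G.edgeSet) p (fun e => e.1 ∈ S) f g ?_ ?_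
  · intro ω ω' h
    exact hf ω ω' h
  · intro ω ω' h
    refine hg ω ω' fun e he => h e fun he' => hST _ he' he

theorem expect_one (G : SimpleGraph V) (p : ℝ) : expect G p (fun _ => 1) = 1 := by
  have := sum_prod_bw (ι := G.edgeSet) p
  unfold expect
  simp only [mul_one]
  exact this

theorem expect_const (G : SimpleGraph V) (p c : ℝ) : expect G p (fun _ => c) = c := by
  have h := expect_one G p
  unfold expect at *
  rw [← Finset.sum_mul]
  simp only [mul_one] at h
  rw [h, one_mul]

theorem expect_add (G : SimpleGraph V) (p : ℝ) (f g : Config G → ℝ) :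
    expect G p (fun ω => f ω + g ω) = expect G p f + expect G p g := by
  unfold expect
  rw [← Finset.sum_add_distrib]
  exact Finset.sum_congr rfl fun _ _ => by ring

theorem expect_sub (G : SimpleGraph V) (p : ℝ) (f g : Config G → ℝ) :
    expect G p (fun ω => f ω - g ω) = expect G p f - expect G p g := by
  unfold expect
  rw [← Finset.sum_sub_distrib]
  exact Finset.sum_congr rfl fun _ _ => by ring

theorem expect_mul (G : SimpleGraph V) (p c : ℝ) (f : Config G → ℝ) :
    expect G p (fun ω => c * f ω) = c * expect G p f := by
  unfold expect
  rw [Finset.mul_sum]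
  exact Finset.sum_congr rfl fun _ _ => by ring

theorem expect_sum (G : SimpleGraph V) (p : ℝ) {α : Type*} (s : Finset α) (f : α → Config G → ℝ) :
    expect G p (fun ω => ∑ a ∈ s, f a ω) = ∑ a ∈ s, expect G p (f a) := by
  unfold expect
  rw [Finset.sum_comm]
  exact Finset.sum_congr rfl fun _ _ => by rw [Finset.mul_sum]

theorem weight_nonneg (G : SimpleGraph V) (p : ℝ) (h0 : 0 ≤ p) (h1 : p ≤ 1) (ω : Config G) :
    0 ≤ weight G p ω := by
  refine Finset.prod_nonneg fun e _ => ?_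
  split_ifs <;> linarith

theorem expect_mono (G : SimpleGraph V) (p : ℝ) (h0 : 0 ≤ p) (h1 : p ≤ 1) (f g : Config G → ℝ)
    (h : ∀ ω, f ω ≤ g ω) : expect G p f ≤ expect G p g :=
  Finset.sum_le_sum fun ω _ => mul_le_mul_of_nonneg_left (h ω) (weight_nonneg G p h0 h1 ω)

theorem expect_nonneg (G : SimpleGraph V) (p : ℝ) (h0 : 0 ≤ p) (h1 : p ≤ 1) (f : Config G → ℝ)
    (h : ∀ ω, 0 ≤ f ω) : 0 ≤ expect G p f :=
  Finset.sum_nonneg fun ω _ => mul_nonneg (weight_nonneg G p h0 h1 ω) (h ω)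

theorem expect_open (G : SimpleGraph V) (p : ℝ) (e : G.edgeSet) :
    expect G p (fun ω => if ω e = true then 1 else 0) = p := by
  have h := Finset.prod_univ_sum (fun _ : G.edgeSet => (Finset.univ : Finset Bool))
    (fun i b => bw p b * (if i = e then (if b = true then 1 else 0) else 1))
  rw [Fintype.piFinset_univ] at h
  have h2 : expect G p (fun ω => if ω e = true then 1 else 0) =
      ∑ x : G.edgeSet → Bool, ∏ i, bw p (x i) *
        (if i = e then (if x i = true then (1:ℝ) else 0) else 1) := by
    refine Finset.sum_congr rfl fun ω _ => ?_
    rw [weight_eq, Finset.prod_mul_distrib]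
    congr 1
    rw [Finset.prod_ite_eq' ]
    simp
  rw [h2, ← h, Finset.prod_eq_single e]
  · simp [bw]
  · intro b _ hb
    simp [hb, bw]
  · simp

theorem occ_adj (G : SimpleGraph V) (ω : Config G) (a b : V) :
    (occupied G ω).Adj a b ↔ ∃ h : s(a, b) ∈ G.edgeSet, ω ⟨s(a, b), h⟩ = true := by
  unfold occupied
  rw [SimpleGraph.fromEdgeSet_adj]
  constructor
  · rintro ⟨h, _⟩
    exact h
  · rintro ⟨h, h'⟩
    refine ⟨⟨h, h'⟩, ?_⟩
    rw [SimpleGraph.mem_edgeSet] at h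
    exact h.ne

theorem occ_adj_congr (G : SimpleGraph V) (ω ω' : Config G) (S : Set (Sym2 V))
    (h : ∀ e : G.edgeSet, e.1 ∈ S → ω e = ω' e) (a b : V) (hab : s(a, b) ∈ S) :
    (occupied G ω).Adj a b ↔ (occupied G ω').Adj a b := by
  rw [occ_adj, occ_adj]
  constructor
  · rintro ⟨h1, h2⟩
    exact ⟨h1, by rw [← h ⟨_, h1⟩ hab]; exact h2⟩
  · rintro ⟨h1, h2⟩
    exact ⟨h1, by rw [h ⟨_, h1⟩ hab]; exact h2⟩

/-- Connection inside the vertex set `B`. -/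
def Conn (G : SimpleGraph V) (ω : Config G) (B : Finset V) : V → V → Prop :=
  Relation.ReflTransGen fun a b => (occupied G ω).Adj a b ∧ a ∈ B ∧ b ∈ B

/-- Cluster of `y` inside the vertex set `B`. -/
def clus (G : SimpleGraph V) (B : Finset V) (y : V) (ω : Config G) : Finset V :=
  Finset.univ.filter fun z => Conn G ω B y z

/-- Union of the `B`-clusters of those vertices in `L` joined to `x` by an occupied bond. -/
def dset (G : SimpleGraph V) (x : V) (L B : Finset V) (ω : Config G) : Finset V :=
  Finset.univ.filter fun z => ∃ y ∈ L, y ∈ B ∧ (occupied G ω).Adj x y ∧ Conn G ω B y z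

theorem mem_clus {G : SimpleGraph V} {B : Finset V} {y z : V} {ω : Config G} :
    z ∈ clus G B y ω ↔ Conn G ω B y z := by simp [clus]

theorem mem_dset {G : SimpleGraph V} {B L : Finset V} {x z : V} {ω : Config G} :
    z ∈ dset G x L B ω ↔ ∃ y ∈ L, y ∈ B ∧ (occupied G ω).Adj x y ∧ Conn G ω B y z := by
  simp [dset]

theorem Conn.mono {G : SimpleGraph V} {ω : Config G} {B B' : Finset V} (h : B ⊆ B') {a b : V}
    (hc : Conn G ω B a b) : Conn G ω B' a b :=
  Relation.ReflTransGen.mono (fun _ _ ⟨h1, h2, h3⟩ => ⟨h1, h h2, h h3⟩) _ _ hc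

theorem Conn.symm {G : SimpleGraph V} {ω : Config G} {B : Finset V} {a b : V}
    (hc : Conn G ω B a b) : Conn G ω B b a := by
  induction hc with
  | refl => exact Relation.ReflTransGen.refl
  | tail _ h ih => exact Relation.ReflTransGen.head ⟨h.1.symm, h.2.2, h.2.1⟩ ih

theorem Conn.mem {G : SimpleGraph V} {ω : Config G} {B : Finset V} {a b : V}
    (hc : Conn G ω B a b) (ha : a ∈ B) : b ∈ B := by
  induction hc with
  | refl => exact ha
  | tail _ h ih => exact h.2.2

theorem clus_subset {G : SimpleGraph V} {B : Finset V} {y : V} {ω : Config G} (hy : y ∈ B) :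
    clus G B y ω ⊆ B := fun _ hz => (mem_clus.1 hz).mem hy

theorem self_mem_clus {G : SimpleGraph V} {B : Finset V} {y : V} {ω : Config G} :
    y ∈ clus G B y ω := mem_clus.2 Relation.ReflTransGen.refl

theorem dset_subset {G : SimpleGraph V} {x : V} {L B : Finset V} {ω : Config G} :
    dset G x L B ω ⊆ B := by
  intro z hz
  obtain ⟨y, _, hy, _, hc⟩ := mem_dset.1 hz
  exact hc.mem hy

theorem dset_mono {G : SimpleGraph V} {x : V} {L L' B B' : Finset V} {ω : Config G}
    (hL : L ⊆ L') (hB : B ⊆ B') : dset G x L B ω ⊆ dset G x L' B' ω := by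
  intro z hz
  obtain ⟨y, h1, hy, h2, hc⟩ := mem_dset.1 hz
  exact mem_dset.2 ⟨y, hL h1, hB hy, h2, hc.mono hB⟩

theorem Conn.sdiff {G : SimpleGraph V} {ω : Config G} {B : Finset V} {y a b : V}
    (hc : Conn G ω B a b) (ha : a ∉ clus G B y ω) : Conn G ω (B \ clus G B y ω) a b := by
  have aux : ∀ c, Conn G ω B a c → c ∉ clus G B y ω := by
    intro c hac hc'
    exact ha (mem_clus.2 ((mem_clus.1 hc').trans hac.symm))
  induction hc with
  | refl => exact Relation.ReflTransGen.refl
  | tail h1 h ih =>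
    refine Relation.ReflTransGen.tail ih ⟨h.1, ?_, ?_⟩
    · exact Finset.mem_sdiff.2 ⟨h.2.1, aux _ h1⟩
    · exact Finset.mem_sdiff.2 ⟨h.2.2, aux _ (h1.tail h)⟩

theorem dset_insert_open {G : SimpleGraph V} {x y : V} {L B : Finset V} {ω : Config G}
    (hy : y ∈ B) (hxy : (occupied G ω).Adj x y) :
    dset G x (insert y L) B ω = clus G B y ω ∪ dset G x L (B \ clus G B y ω) ω := by
  ext z
  rw [Finset.mem_union, mem_dset, mem_dset, mem_clus]
  constructor
  · rintro ⟨y', hy', hB, hadj, hc⟩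
    rcases Finset.mem_insert.1 hy' with rfl | hL
    · exact Or.inl hc
    · by_cases hyc : y' ∈ clus G B y ω
      · exact Or.inl ((mem_clus.1 hyc).trans hc)
      · exact Or.inr ⟨y', hL, Finset.mem_sdiff.2 ⟨hB, hyc⟩, hadj, hc.sdiff hyc⟩
  · rintro (hc | ⟨y', hL, hB, hadj, hc⟩)
    · exact ⟨y, Finset.mem_insert_self _ _, hy, hxy, hc⟩
    · exact ⟨y', Finset.mem_insert_of_mem hL, (Finset.mem_sdiff.1 hB).1, hadj,
        hc.mono Finset.sdiff_subset⟩

theorem card_dset_insert_open {G : SimpleGraph V} {x y : V} {L B : Finset V} {ω : Config G}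
    (hy : y ∈ B) (hxy : (occupied G ω).Adj x y) :
    (dset G x (insert y L) B ω).card =
      (clus G B y ω).card + (dset G x L (B \ clus G B y ω) ω).card := by
  rw [dset_insert_open hy hxy, Finset.card_union_of_disjoint]
  rw [Finset.disjoint_right]
  intro z hz
  exact (Finset.mem_sdiff.1 (dset_subset hz)).2

theorem dset_insert_closed {G : SimpleGraph V} {x y : V} {L B : Finset V} {ω : Config G}
    (h : ¬ (y ∈ B ∧ (occupied G ω).Adj x y)) :
    dset G x (insert y L) B ω = dset G x L B ω := by
  ext z
  rw [mem_dset, mem_dset]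
  constructor
  · rintro ⟨y', hy', hB, hadj, hc⟩
    rcases Finset.mem_insert.1 hy' with rfl | hL
    · exact absurd ⟨hB, hadj⟩ h
    · exact ⟨y', hL, hB, hadj, hc⟩
  · rintro ⟨y', hL, hB, hadj, hc⟩
    exact ⟨y', Finset.mem_insert_of_mem hL, hB, hadj, hc⟩

theorem clus_eq_insert {G : SimpleGraph V} {y : V} {B : Finset V} {ω : Config G} (hy : y ∈ B) :
    clus G B y ω = insert y (dset G y Finset.univ (B.erase y) ω) := by
  ext z
  rw [mem_clus, Finset.mem_insert]
  constructor
  · intro hc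
    induction hc with
    | refl => exact Or.inl rfl
    | @tail b c h1 h ih =>
      by_cases hcy : c = y
      · exact Or.inl hcy
      right
      have hcB : c ∈ B.erase y := Finset.mem_erase.2 ⟨hcy, h.2.2⟩
      rcases ih with rfl | ih
      · exact mem_dset.2 ⟨c, Finset.mem_univ _, hcB, h.1, Relation.ReflTransGen.refl⟩
      · have hb := dset_subset ih
        obtain ⟨y', hL, hB, hadj, hc⟩ := mem_dset.1 ih
        exact mem_dset.2 ⟨y', hL, hB, hadj, hc.tail ⟨h.1, hb, hcB⟩⟩
  · rintro (rfl | h)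
    · exact Relation.ReflTransGen.refl
    · obtain ⟨y', hL, hB, hadj, hc⟩ := mem_dset.1 h
      exact Relation.ReflTransGen.head ⟨hadj, hy, (Finset.mem_erase.1 hB).2⟩
        (hc.mono (Finset.erase_subset _ _))

theorem card_clus {G : SimpleGraph V} {y : V} {B : Finset V} {ω : Config G} (hy : y ∈ B) :
    (clus G B y ω).card = 1 + (dset G y Finset.univ (B.erase y) ω).card := by
  rw [clus_eq_insert hy, Finset.card_insert_of_notMem, add_comm]
  intro h
  exact absurd (dset_subset h) (Finset.notMem_erase _ _)

theorem clus_univ (G : SimpleGraph V) (y : V) (ω : Config G) :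
    clus G Finset.univ y ω = cluster G ω y := by
  ext z
  rw [mem_clus]
  unfold cluster Conn
  simp only [Finset.mem_filter, Finset.mem_univ, true_and, and_true]
  rw [SimpleGraph.reachable_iff_reflTransGen]

/-- bonds inside `B` touching `C` -/
def touch (B C : Finset V) : Set (Sym2 V) :=
  {e | (∃ z ∈ C, z ∈ e) ∧ ∀ z ∈ e, z ∈ B}

theorem clus_dep_aux (G : SimpleGraph V) (B C : Finset V) (y : V) (ω ω' : Config G)
    (h : ∀ e : G.edgeSet, e.1 ∈ touch B C → ω e = ω' e) (hC : clus G B y ω = C) :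
    clus G B y ω' = C := by
  have hmem : ∀ a b, (a ∈ C) → a ∈ B → b ∈ B → s(a, b) ∈ touch B C := by
    intro a b haC ha hb
    refine ⟨⟨a, haC, Sym2.mem_mk_left _ _⟩, fun z hz => ?_⟩
    rcases Sym2.mem_iff.1 hz with rfl | rfl <;> assumption
  ext z
  constructor
  · intro hz
    rw [mem_clus] at hz
    induction hz with
    | refl => rw [← hC]; exact self_mem_clus
    | tail h1 hab ih =>
      have := (occ_adj_congr G ω ω' _ h _ _ (hmem _ _ ih hab.2.1 hab.2.2)).2 hab.1
      rw [← hC, mem_clus] at ih ⊢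
      exact ih.tail ⟨this, hab.2⟩
  · intro hz
    rw [← hC, mem_clus] at hz
    induction hz with
    | refl => exact self_mem_clus
    | tail h1 hab ih =>
      have hin := mem_clus.2 h1
      rw [hC] at hin
      have := (occ_adj_congr G ω ω' _ h _ _ (hmem _ _ hin hab.2.1 hab.2.2)).1 hab.1
      rw [mem_clus] at ih ⊢
      exact ih.tail ⟨this, hab.2⟩

theorem clus_dep (G : SimpleGraph V) (B C : Finset V) (y : V) :
    Dep G (fun ω => if clus G B y ω = C then (1 : ℝ) else 0) (touch B C) := by
  intro ω ω' h
  have : clus G B y ω = C ↔ clus G B y ω' = C :=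
    ⟨clus_dep_aux G B C y ω ω' h, clus_dep_aux G B C y ω' ω fun e he => (h e he).symm⟩
  simp only [this]

/-- bonds relevant for `dset` -/
def dbonds (x : V) (L B : Finset V) : Set (Sym2 V) :=
  {e | (∀ z ∈ e, z ∈ B) ∨ ∃ y ∈ L, y ∈ B ∧ e = s(x, y)}

theorem dset_dep (G : SimpleGraph V) (x : V) (L B : Finset V) :
    Dep G (dset G x L B) (dbonds x L B) := by
  have key : ∀ ω ω' : Config G, (∀ e : G.edgeSet, e.1 ∈ dbonds x L B → ω e = ω' e) →
      dset G x L B ω ⊆ dset G x L B ω' := by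
    intro ω ω' h z hz
    obtain ⟨y, hL, hB, hadj, hc⟩ := mem_dset.1 hz
    refine mem_dset.2 ⟨y, hL, hB, ?_, ?_⟩
    · exact (occ_adj_congr G ω ω' _ h _ _ (Or.inr ⟨y, hL, hB, rfl⟩)).1 hadj
    · refine Relation.ReflTransGen.mono ?_ _ _ hc
      rintro a b ⟨h1, ha, hb⟩
      refine ⟨(occ_adj_congr G ω ω' _ h _ _ (Or.inl fun z hz => ?_)).1 h1, ha, hb⟩
      rcases Sym2.mem_iff.1 hz with rfl | rfl <;> assumption
  intro ω ω' h
  exact Finset.Subset.antisymm (key ω ω' h) (key ω' ω fun e he => (h e he).symm)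

/-- probability of exactly one green vertex among `n` -/
def oo (γ : ℝ) (n : ℕ) : ℝ := n * γ * (1 - γ) ^ (n - 1)

/-- probability of at least two green vertices among `n` -/
def tt (γ : ℝ) (n : ℕ) : ℝ := 1 - (1 - γ) ^ n - oo γ n

/-- expected number of vertices visited up to the first green one -/
def vv (γ : ℝ) (n : ℕ) : ℝ := ∑ j ∈ Finset.range n, (1 - γ) ^ j

theorem oo_add (γ : ℝ) (k l : ℕ) :
    oo γ (k + l) = oo γ k * (1 - γ) ^ l + (1 - γ) ^ k * oo γ l := by
  unfold oo
  rcases k with _ | k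
  · simp
  rcases l with _ | l
  · simp
  have h1 : k + 1 + (l + 1) - 1 = k + l + 1 := by omega
  rw [h1]
  simp only [Nat.add_sub_cancel]
  push_cast
  ring

theorem tt_add (γ : ℝ) (k l : ℕ) :
    tt γ (k + l) = tt γ k + oo γ k * (1 - (1 - γ) ^ l) + (1 - γ) ^ k * tt γ l := by
  unfold tt
  rw [oo_add, pow_add]; ring

theorem vv_add (γ : ℝ) (k l : ℕ) : vv γ (k + l) = vv γ k + (1 - γ) ^ k * vv γ l := by
  unfold vv
  rw [Finset.sum_range_add, Finset.mul_sum]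
  simp only [pow_add]

theorem vv_mul (γ : ℝ) (n : ℕ) : γ * vv γ n = 1 - (1 - γ) ^ n := by
  have := mul_neg_geom_sum (1 - γ) n
  unfold vv
  rw [← this]; ring

theorem vv_nonneg (γ : ℝ) (h1 : γ ≤ 1) (n : ℕ) : 0 ≤ vv γ n :=
  Finset.sum_nonneg fun _ _ => pow_nonneg (by linarith) _

theorem oo_nonneg (γ : ℝ) (h0 : 0 ≤ γ) (h1 : γ ≤ 1) (n : ℕ) : 0 ≤ oo γ n := by
  unfold oo
  have : 0 ≤ 1 - γ := by linarith
  positivity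

theorem tt_nonneg (γ : ℝ) (h0 : 0 ≤ γ) (h1 : γ ≤ 1) (n : ℕ) : 0 ≤ tt γ n := by
  induction n with
  | zero => simp [tt, oo]
  | succ n ih =>
    rw [add_comm, tt_add]
    have e1 : tt γ 1 = 0 := by simp [tt, oo]
    rw [e1]
    have h2 : (1 - γ) ^ n ≤ 1 := pow_le_one₀ (by linarith) (by linarith)
    have h3 := oo_nonneg γ h0 h1 1
    have h4 : 0 ≤ (1 - γ) ^ 1 * tt γ n := mul_nonneg (by simpa using h1) ih
    nlinarith [mul_nonneg h3 (sub_nonneg.2 h2)]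

/-- indicator that the bond `xy` is occupied -/
def op (G : SimpleGraph V) (x y : V) (ω : Config G) : ℝ :=
  if (occupied G ω).Adj x y then 1 else 0

theorem op_dep (G : SimpleGraph V) (x y : V) : Dep G (op G x y) {s(x, y)} := by
  intro ω ω' h
  unfold op
  have := occ_adj_congr G ω ω' _ h x y rfl
  simp only [this]

theorem op_expect (G : SimpleGraph V) (p : ℝ) (x y : V) (h : G.Adj x y) :
    expect G p (op G x y) = p := by
  have h' : s(x, y) ∈ G.edgeSet := h
  refine Eq.trans ?_ (expect_open G p ⟨s(x, y), h'⟩)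
  congr 1
  funext ω
  unfold op
  have : (occupied G ω).Adj x y ↔ ω ⟨s(x, y), h'⟩ = true := by
    rw [occ_adj]; exact ⟨fun ⟨_, h⟩ => h, fun h => ⟨_, h⟩⟩
  simp only [this]

theorem Dep.comp {G : SimpleGraph V} {α β : Type*} {f : Config G → α} {S : Set (Sym2 V)}
    (h : Dep G f S) (g : α → β) : Dep G (fun ω => g (f ω)) S := by
  intro ω ω' hh
  exact congrArg g (h ω ω' hh)

theorem Dep.mul {G : SimpleGraph V} {f g : Config G → ℝ} {S T : Set (Sym2 V)}
    (hf : Dep G f S) (hg : Dep G g T) : Dep G (fun ω => f ω * g ω) (S ∪ T) := by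
  intro ω ω' hh
  show f ω * g ω = f ω' * g ω'
  rw [show f ω = f ω' from hf ω ω' fun e he => hh e (Or.inl he),
    show g ω = g ω' from hg ω ω' fun e he => hh e (Or.inr he)]

/-- Markov property of the exploration. -/
theorem expect_step (G : SimpleGraph V) (p : ℝ) (x y : V) (L B : Finset V) (hx : x ∉ B)
    (hy : y ∈ B) (hyL : y ∉ L) (hxy : G.Adj x y) (φ : ℕ → ℝ) :
    expect G p (fun ω => φ (dset G x (insert y L) B ω).card) =
      (1 - p) * expect G p (fun ω => φ (dset G x L B ω).card) +
      p * ∑ C ∈ B.powerset, (expect G p fun ω => if clus G B y ω = C then (1 : ℝ) else 0) *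
        (if y ∈ C then expect G p (fun ω => φ (C.card + (dset G x L (B \ C) ω).card)) else 0) := by
  have hpt : ∀ ω, φ (dset G x (insert y L) B ω).card =
      (1 - op G x y ω) * φ (dset G x L B ω).card +
      ∑ C ∈ B.powerset, op G x y ω * ((if clus G B y ω = C then (1 : ℝ) else 0) *
        (if y ∈ C then φ (C.card + (dset G x L (B \ C) ω).card) else 0)) := by
    intro ω
    by_cases h : (occupied G ω).Adj x y
    · rw [Finset.sum_eq_single (clus G B y ω)]
      · rw [card_dset_insert_open hy h]
        simp [op, h, self_mem_clus]
      · intro C _ hC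
        simp [Ne.symm hC]
      · intro hC
        exact absurd (Finset.mem_powerset.2 (clus_subset hy)) hC
    · rw [dset_insert_closed (fun h' => h h'.2)]
      simp [op, h]
  have hxyB : ∀ S : Finset V, S ⊆ B → s(x, y) ∉ dbonds x L S := by
    intro S hS h
    rcases h with h | ⟨y', hy', hB, he⟩
    · exact hx (hS (h x (Sym2.mem_mk_left _ _)))
    · rcases Sym2.eq_iff.1 he with ⟨_, rfl⟩ | ⟨rfl, rfl⟩
      · exact hyL hy'
      · exact hx hy
  have h1 : expect G p (fun ω => (1 - op G x y ω) * φ (dset G x L B ω).card) =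
      (1 - p) * expect G p (fun ω => φ (dset G x L B ω).card) := by
    rw [expect_indep G p (fun ω => 1 - op G x y ω) (fun ω => φ (dset G x L B ω).card) {s(x, y)}
      (dbonds x L B), expect_sub, op_expect G p x y hxy, expect_one]
    · exact (op_dep G x y).comp fun a => 1 - a
    · exact (dset_dep G x L B).comp fun D => φ D.card
    · rintro e rfl
      exact hxyB B (Finset.Subset.refl _)
  have h2 : ∀ C ∈ B.powerset, expect G p (fun ω => op G x y ω *
        ((if clus G B y ω = C then (1 : ℝ) else 0) *
        (if y ∈ C then φ (C.card + (dset G x L (B \ C) ω).card) else 0))) =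
      p * ((expect G p fun ω => if clus G B y ω = C then (1 : ℝ) else 0) *
        (if y ∈ C then expect G p (fun ω => φ (C.card + (dset G x L (B \ C) ω).card)) else 0)) := by
    intro C hC
    rw [Finset.mem_powerset] at hC
    by_cases hyC : y ∈ C
    · simp only [hyC, if_true]
      have hd : Dep G (fun ω => φ (C.card + (dset G x L (B \ C) ω).card)) (dbonds x L (B \ C)) :=
        (dset_dep G x L (B \ C)).comp fun D => φ (C.card + D.card)
      have hc := clus_dep G B C y
      rw [expect_indep G p (op G x y) _ {s(x, y)} (touch B C ∪ dbonds x L (B \ C)) (op_dep G x y)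
        (hc.mul hd), op_expect G p x y hxy, expect_indep G p _ _ _ _ hc hd]
      · rintro e ⟨⟨z, hz, hze⟩, he⟩ (h | ⟨y', hy', hB, rfl⟩)
        · exact (Finset.mem_sdiff.1 (h z hze)).2 hz
        · exact hx (he x (Sym2.mem_mk_left _ _))
      · rintro e rfl (h | h)
        · exact hx (h.2 x (Sym2.mem_mk_left _ _))
        · exact hxyB _ Finset.sdiff_subset h
    · simp [hyC, expect_const]
  calc _ = expect G p (fun ω => (1 - op G x y ω) * φ (dset G x L B ω).card +
      ∑ C ∈ B.powerset, op G x y ω * ((if clus G B y ω = C then (1 : ℝ) else 0) *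
        (if y ∈ C then φ (C.card + (dset G x L (B \ C) ω).card) else 0))) := by
        congr 1; funext ω; exact hpt ω
    _ = _ := by
      rw [expect_add, h1, expect_sum, Finset.sum_congr rfl h2, ← Finset.mul_sum]

theorem expect_clus (G : SimpleGraph V) (p : ℝ) (y : V) (B : Finset V) (hy : y ∈ B) (φ : ℕ → ℝ) :
    ∑ C ∈ B.powerset, (expect G p fun ω => if clus G B y ω = C then (1 : ℝ) else 0) *
        (if y ∈ C then φ C.card else 0) = expect G p (fun ω => φ (clus G B y ω).card) := by
  have hpt : ∀ ω, φ (clus G B y ω).card = ∑ C ∈ B.powerset, (if y ∈ C then φ C.card else 0) *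
      (if clus G B y ω = C then (1 : ℝ) else 0) := by
    intro ω
    rw [Finset.sum_eq_single (clus G B y ω)]
    · simp [self_mem_clus]
    · intro C _ hC
      simp [Ne.symm hC]
    · intro hC
      exact absurd (Finset.mem_powerset.2 (clus_subset hy)) hC
  simp only [hpt]
  rw [expect_sum]
  refine Finset.sum_congr rfl fun C _ => ?_
  rw [expect_mul]; ring

theorem clus_ineq (G : SimpleGraph V) (p γ m : ℝ) (hp0 : 0 ≤ p) (hp1 : p ≤ 1) (h0 : 0 ≤ γ)
    (h1 : γ ≤ 1) (β : ℝ) (hβ : m * (γ + (1 - γ) * m) ≤ β) (B : Finset V) (y : V) (hy : y ∈ B)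
    (hmm : expect G p
      (fun ω => 1 - (1 - γ) ^ (dset G y Finset.univ (B.erase y) ω).card) ≤ m)
    (hi : expect G p (fun ω => tt γ (dset G y Finset.univ (B.erase y) ω).card
      - m * (1 - (1 - γ) ^ (dset G y Finset.univ (B.erase y) ω).card)
        - β * vv γ (dset G y Finset.univ (B.erase y) ω).card) ≤ 0) :
    expect G p
      (fun ω => tt γ (clus G B y ω).card - β * vv γ (clus G B y ω).card) ≤ 0 := by
  have hq : 0 ≤ 1 - γ := by linarith
  have hm0 : 0 ≤ m := by
    refine le_trans ?_ hmm
    rw [← expect_const G p 0]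
    refine expect_mono G p hp0 hp1 _ _ fun ω => ?_
    have : (1 - γ) ^ (dset G y Finset.univ (B.erase y) ω).card ≤ 1 :=
      pow_le_one₀ hq (by linarith)
    linarith
  have e : ∀ ω, tt γ (clus G B y ω).card - β * vv γ (clus G B y ω).card =
      ((1 - γ) * (tt γ (dset G y Finset.univ (B.erase y) ω).card
        - m * (1 - (1 - γ) ^ (dset G y Finset.univ (B.erase y) ω).card)
      - β * vv γ (dset G y Finset.univ (B.erase y) ω).card) +
      (γ + (1 - γ) * m) * (1 - (1 - γ) ^ (dset G y Finset.univ (B.erase y) ω).card)) - β := by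
    intro ω
    rw [card_clus hy, tt_add, vv_add]
    simp only [tt, oo, vv]
    simp
    ring
  simp only [e]
  rw [expect_sub, expect_add, expect_mul, expect_mul, expect_const]
  have a1 := mul_nonneg hq (neg_nonneg.2 hi)
  have a2 : 0 ≤ γ + (1 - γ) * m := by positivity
  have a3 := mul_le_mul_of_nonneg_left hmm a2
  linarith

theorem main_ineq (G : SimpleGraph V) (p γ m : ℝ) (hp0 : 0 ≤ p) (hp1 : p ≤ 1) (h0 : 0 ≤ γ)
    (h1 : γ ≤ 1)
    (hm : ∀ (x : V) (L B : Finset V), x ∉ B →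
      expect G p (fun ω => 1 - (1 - γ) ^ (dset G x L B ω).card) ≤ m)
    (β : ℝ) (hβ : m * (γ + (1 - γ) * m) ≤ β) (B : Finset V) :
    ∀ x : V, x ∉ B → ∀ L : Finset V,
      expect G p (fun ω => tt γ (dset G x L B ω).card - m * (1 - (1 - γ) ^ (dset G x L B ω).card)
        - β * vv γ (dset G x L B ω).card) ≤ 0 := by
  have hq : 0 ≤ 1 - γ := by linarith
  induction B using Finset.strongInduction with
  | H B ih =>
  intro x hx L
  -- the cluster version
  have hcl : ∀ y ∈ B, expect G p
      (fun ω => tt γ (clus G B y ω).card - β * vv γ (clus G B y ω).card) ≤ 0 := by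
    intro y hy
    have hyE : y ∉ B.erase y := Finset.notMem_erase _ _
    have hi := ih (B.erase y) (Finset.erase_ssubset hy) y hyE Finset.univ
    have hmm := hm y Finset.univ (B.erase y) hyE
    exact clus_ineq G p γ m hp0 hp1 h0 h1 β hβ B y hy hmm hi
  induction L using Finset.induction_on with
  | empty =>
    have : ∀ ω, dset G x ∅ B ω = ∅ := fun ω => by simp [dset]
    simp only [this, Finset.card_empty]
    simp [tt, oo, vv, expect_const]
  | insert y L hyL ihL =>
    by_cases hy : y ∈ B ∧ G.Adj x y
    · obtain ⟨hy, hxy⟩ := hy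
      have := expect_step G p x y L B hx hy hyL hxy
        (fun n => tt γ n - m * (1 - (1 - γ) ^ n) - β * vv γ n)
      rw [this]
      have b1 := mul_nonneg (sub_nonneg.2 hp1) (neg_nonneg.2 ihL)
      have b2 : ∑ C ∈ B.powerset, (expect G p fun ω => if clus G B y ω = C then (1 : ℝ) else 0) *
        (if y ∈ C then expect G p (fun ω => tt γ (C.card + (dset G x L (B \ C) ω).card)
          - m * (1 - (1 - γ) ^ (C.card + (dset G x L (B \ C) ω).card))
          - β * vv γ (C.card + (dset G x L (B \ C) ω).card)) else 0) ≤ 0 := by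
        refine le_trans ?_ (hcl y hy)
        rw [← expect_clus G p y B hy (fun n => tt γ n - β * vv γ n)]
        refine Finset.sum_le_sum fun C hC => ?_
        refine mul_le_mul_of_nonneg_left ?_ ?_
        · by_cases hyC : y ∈ C
          · simp only [hyC, if_true]
            have hss : B \ C ⊂ B := by
              refine Finset.ssubset_iff_subset_ne.2 ⟨Finset.sdiff_subset, fun h => ?_⟩
              rw [← h] at hy
              exact (Finset.mem_sdiff.1 hy).2 hyC
            have hxx : x ∉ B \ C := fun h => hx (Finset.mem_sdiff.1 h).1
            have hi := ih (B \ C) hss x hxx L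
            have hmm := hm x L (B \ C) hxx
            have e : ∀ ω, tt γ (C.card + (dset G x L (B \ C) ω).card)
              - m * (1 - (1 - γ) ^ (C.card + (dset G x L (B \ C) ω).card))
              - β * vv γ (C.card + (dset G x L (B \ C) ω).card) =
              ((1 - γ) ^ C.card * (tt γ (dset G x L (B \ C) ω).card
                - m * (1 - (1 - γ) ^ (dset G x L (B \ C) ω).card)
                - β * vv γ (dset G x L (B \ C) ω).card) +
              oo γ C.card * (1 - (1 - γ) ^ (dset G x L (B \ C) ω).card)) +
              (tt γ C.card - β * vv γ C.card - m * (1 - (1 - γ) ^ C.card)) := by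
              intro ω
              rw [tt_add, vv_add, pow_add]; ring
            simp only [e]
            rw [expect_add, expect_add, expect_mul, expect_mul, expect_const]
            have c1 := mul_nonneg (pow_nonneg hq C.card) (neg_nonneg.2 hi)
            have c2 := mul_le_mul_of_nonneg_left hmm (oo_nonneg γ h0 h1 C.card)
            have hm0 : 0 ≤ m := by
              refine le_trans ?_ hmm
              rw [← expect_const G p 0]
              refine expect_mono G p hp0 hp1 _ _ fun ω => ?_
              have : (1 - γ) ^ (dset G x L (B \ C) ω).card ≤ 1 :=
                pow_le_one₀ hq (by linarith)
              linarith
            have c3 : oo γ C.card ≤ 1 - (1 - γ) ^ C.card := by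
              have := tt_nonneg γ h0 h1 C.card
              unfold tt at this; linarith
            have c4 := mul_le_mul_of_nonneg_left c3 hm0
            linarith
          · simp [hyC]
        · refine expect_nonneg G p hp0 hp1 _ fun ω => ?_
          split_ifs <;> norm_num
      have b3 := mul_nonneg hp0 (neg_nonneg.2 b2)
      linarith
    · have : ∀ ω, dset G x (insert y L) B ω = dset G x L B ω := by
        intro ω
        refine dset_insert_closed fun h => hy ⟨h.1, ?_⟩
        obtain ⟨h', _⟩ := (occ_adj G ω x y).1 h.2
        exact h'
      simp only [this]
      exact ihL

theorem expect_iso (G : SimpleGraph V) (p : ℝ) (φ : G ≃g G) (x : V) (f : ℕ → ℝ) :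
    expect G p (fun ω => f (cluster G ω (φ x)).card) =
      expect G p (fun ω => f (cluster G ω x).card) := by
  let E : Config G ≃ Config G := Equiv.arrowCongr φ.mapEdgeSet.symm (Equiv.refl Bool)
  have hE : ∀ ω e, E ω e = ω (φ.mapEdgeSet e) := fun ω e => rfl
  have hw : ∀ ω, weight G p (E ω) = weight G p ω := by
    intro ω
    rw [weight_eq, weight_eq]
    simp only [hE]
    exact Equiv.prod_comp φ.mapEdgeSet fun e => bw p (ω e)
  have hadj : ∀ ω a b, (occupied G ω).Adj (φ a) (φ b) ↔ (occupied G (E ω)).Adj a b := by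
    intro ω a b
    rw [occ_adj, occ_adj]
    constructor
    · rintro ⟨h, h'⟩
      exact ⟨φ.map_adj_iff.1 h, h'⟩
    · rintro ⟨h, h'⟩
      exact ⟨φ.map_adj_iff.2 h, h'⟩
  have hcard : ∀ ω, (cluster G ω (φ x)).card = (cluster G (E ω) x).card := by
    intro ω
    let ψ : occupied G (E ω) ≃g occupied G ω := ⟨φ.toEquiv, fun {a b} => hadj ω a b⟩
    symm
    refine Finset.card_equiv φ.toEquiv fun z => ?_
    simp only [cluster, Finset.mem_filter, Finset.mem_univ, true_and]
    exact (SimpleGraph.Iso.reachable_iff (φ := ψ)).symm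
  symm
  unfold expect
  rw [← Equiv.sum_comp E]
  refine Finset.sum_congr rfl fun ω _ => ?_
  show weight G p (E ω) * f (cluster G (E ω) x).card = weight G p ω * f (cluster G ω (φ x)).card
  rw [hw, hcard]

theorem clus_dep' (G : SimpleGraph V) (B : Finset V) (y : V) :
    Dep G (clus G B y) {e | ∀ z ∈ e, z ∈ B} := by
  have key : ∀ ω ω' : Config G, (∀ e : G.edgeSet, e.1 ∈ {e : Sym2 V | ∀ z ∈ e, z ∈ B} →
      ω e = ω' e) → clus G B y ω ⊆ clus G B y ω' := by
    intro ω ω' h z hz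
    refine mem_clus.2 (Relation.ReflTransGen.mono ?_ _ _ (mem_clus.1 hz))
    rintro a b ⟨h1, ha, hb⟩
    refine ⟨(occ_adj_congr G ω ω' _ h _ _ (fun z hz => ?_)).1 h1, ha, hb⟩
    rcases Sym2.mem_iff.1 hz with rfl | rfl <;> assumption
  intro ω ω' h
  exact Finset.Subset.antisymm (key ω ω' h) (key ω' ω fun e he => (h e he).symm)

theorem one_sub_pow_mono (γ : ℝ) (h0 : 0 ≤ γ) (h1 : γ ≤ 1) {a b : ℕ} (h : a ≤ b) :
    1 - (1 - γ) ^ a ≤ 1 - (1 - γ) ^ b := by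
  have := pow_le_pow_of_le_one (by linarith : 0 ≤ 1 - γ) (by linarith) h
  linarith

theorem one_sub_pow_nonneg (γ : ℝ) (h0 : 0 ≤ γ) (h1 : γ ≤ 1) (a : ℕ) :
    0 ≤ 1 - (1 - γ) ^ a := by
  have := one_sub_pow_mono γ h0 h1 (Nat.zero_le a)
  simpa using this

theorem union_bound (G : SimpleGraph V) (γ : ℝ) (h0 : 0 ≤ γ) (h1 : γ ≤ 1) (x : V)
    (L B : Finset V) (ω : Config G) :
    1 - (1 - γ) ^ (dset G x L B ω).card ≤
      ∑ y ∈ L, op G x y ω * (1 - (1 - γ) ^ (clus G B y ω).card) := by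
  induction L using Finset.induction_on with
  | empty =>
    have : dset G x ∅ B ω = ∅ := by simp [dset]
    simp [this]
  | insert y L hyL ih =>
    rw [Finset.sum_insert hyL]
    have hc := one_sub_pow_nonneg γ h0 h1 (clus G B y ω).card
    by_cases h : y ∈ B ∧ (occupied G ω).Adj x y
    · rw [card_dset_insert_open h.1 h.2]
      have h2 : (dset G x L (B \ clus G B y ω) ω).card ≤ (dset G x L B ω).card :=
        Finset.card_le_card (dset_mono (Finset.Subset.refl _) Finset.sdiff_subset)
      have h3 := one_sub_pow_mono γ h0 h1 h2
      have h4 := one_sub_pow_nonneg γ h0 h1 (dset G x L (B \ clus G B y ω) ω).card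
      have h5 : op G x y ω = 1 := by simp [op, h.2]
      rw [h5, pow_add]
      nlinarith [mul_nonneg hc h4]
    · rw [dset_insert_closed h]
      have : 0 ≤ op G x y ω := by unfold op; split_ifs <;> norm_num
      have := mul_nonneg this hc
      linarith

theorem m_le (G : SimpleGraph V) [DecidableRel G.Adj] (p γ M : ℝ) (hp0 : 0 ≤ p) (hp1 : p ≤ 1)
    (h0 : 0 ≤ γ) (h1 : γ ≤ 1) (x : V)
    (hM : ∀ y : V, expect G p (fun ω => 1 - (1 - γ) ^ (cluster G ω y).card) = M) :
    expect G p (fun ω => 1 - (1 - γ) ^ (dset G x Finset.univ (Finset.univ.erase x) ω).card) ≤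
      G.degree x * p * M := by
  refine le_trans (expect_mono G p hp0 hp1 _ _ fun ω => union_bound G γ h0 h1 x _ _ ω) ?_
  rw [expect_sum]
  have hterm : ∀ y ∈ (Finset.univ : Finset V),
      expect G p (fun ω => op G x y ω * (1 - (1 - γ) ^ (clus G (Finset.univ.erase x) y ω).card)) ≤
      if y ∈ G.neighborFinset x then p * M else 0 := by
    intro y _
    by_cases hxy : G.Adj x y
    · rw [if_pos (by simpa using hxy)]
      rw [expect_indep G p _ _ _ _ (op_dep G x y)
        ((clus_dep' G (Finset.univ.erase x) y).comp fun C => 1 - (1 - γ) ^ C.card),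
        op_expect G p x y hxy]
      · refine mul_le_mul_of_nonneg_left ?_ hp0
        rw [← hM y]
        refine expect_mono G p hp0 hp1 _ _ fun ω => one_sub_pow_mono γ h0 h1 ?_
        rw [← clus_univ]
        refine Finset.card_le_card fun z hz => ?_
        exact mem_clus.2 ((mem_clus.1 hz).mono (Finset.subset_univ _))
      · rintro e rfl h
        exact Finset.notMem_erase x _ (h x (Sym2.mem_mk_left _ _))
    · rw [if_neg (by simpa using hxy)]
      have : ∀ ω, op G x y ω = 0 := by
        intro ω
        unfold op
        rw [if_neg]
        intro h
        obtain ⟨h', _⟩ := (occ_adj G ω x y).1 h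
        exact hxy h'
      simp only [this, zero_mul]
      rw [expect_const]
  refine le_trans (Finset.sum_le_sum hterm) ?_
  rw [Finset.sum_ite_mem, Finset.univ_inter, Finset.sum_const, SimpleGraph.card_neighborFinset_eq_degree,
    nsmul_eq_mul, mul_assoc]

/-- The key inequality `𝔼 t(|C|) ≤ c M² 𝔼 v(|C|)`. -/
theorem key_ineq (G : SimpleGraph V) [DecidableRel G.Adj] (htrans : IsTransitive G)
    (Ω : ℕ) (hreg : G.IsRegularOfDegree Ω) (x₀ : V) (p γ : ℝ) (hp0 : 0 ≤ p) (hp1 : p ≤ 1)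
    (h0 : 0 < γ) (h1 : γ < 1) (c : ℝ) (hc : c = 1 ∨ c = Ω * p) :
    expect G p (fun ω => tt γ (cluster G ω x₀).card) ≤
      c * (expect G p (fun ω => 1 - (1 - γ) ^ (cluster G ω x₀).card)) ^ 2 *
        expect G p (fun ω => vv γ (cluster G ω x₀).card) := by
  set M := expect G p (fun ω => 1 - (1 - γ) ^ (cluster G ω x₀).card) with hMdef
  have hM : ∀ y : V, expect G p (fun ω => 1 - (1 - γ) ^ (cluster G ω y).card) = M := by
    intro y
    obtain ⟨φ, rfl⟩ := htrans x₀ y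
    exact expect_iso G p φ x₀ fun n => 1 - (1 - γ) ^ n
  set m := (M - γ) / (1 - γ) with hm
  have hq : 0 < 1 - γ := by linarith
  have hmM : γ + (1 - γ) * m = M := by rw [hm]; field_simp; ring
  have hmx : ∀ x, expect G p
      (fun ω => 1 - (1 - γ) ^ (dset G x Finset.univ (Finset.univ.erase x) ω).card) = m := by
    intro x
    have e : ∀ ω, 1 - (1 - γ) ^ (cluster G ω x).card =
        (1 - γ) * (1 - (1 - γ) ^ (dset G x Finset.univ (Finset.univ.erase x) ω).card) + γ := by
      intro ω
      rw [← clus_univ, card_clus (Finset.mem_univ x), pow_add]; ring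
    have h := hM x
    simp only [e] at h
    rw [expect_add, expect_mul, expect_const] at h
    rw [hm, eq_div_iff hq.ne']
    linarith
  have hmle : ∀ (x : V) (L B : Finset V), x ∉ B →
      expect G p (fun ω => 1 - (1 - γ) ^ (dset G x L B ω).card) ≤ m := by
    intro x L B hx
    rw [← hmx x]
    refine expect_mono G p hp0 hp1 _ _ fun ω => one_sub_pow_mono γ h0.le h1.le ?_
    refine Finset.card_le_card (dset_mono (Finset.subset_univ _) fun z hz => ?_)
    refine Finset.mem_erase.2 ⟨?_, Finset.mem_univ _⟩
    rintro rfl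
    exact hx hz
  have hM1 : M ≤ 1 := by
    rw [hMdef]
    refine (expect_mono G p hp0 hp1 _ (fun _ => 1) fun ω => ?_).trans (expect_one G p).le
    have : 0 ≤ (1 - γ) ^ (cluster G ω x₀).card := pow_nonneg hq.le _
    linarith
  have hM0 : 0 ≤ M := expect_nonneg G p hp0 hp1 _ fun ω => one_sub_pow_nonneg γ h0.le h1.le _
  have hmc : m ≤ c * M := by
    rcases hc with rfl | rfl
    · rw [hm, div_le_iff₀ hq]; nlinarith
    · have := m_le G p γ M hp0 hp1 h0.le h1.le x₀ hM
      rw [hmx, hreg x₀] at this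
      exact this
  have hβ : m * (γ + (1 - γ) * m) ≤ c * M ^ 2 := by
    rw [hmM]; nlinarith
  have hi := main_ineq G p γ m hp0 hp1 h0.le h1.le hmle (c * M ^ 2) hβ (Finset.univ.erase x₀) x₀
    (Finset.notMem_erase _ _) Finset.univ
  have hfin := clus_ineq G p γ m hp0 hp1 h0.le h1.le (c * M ^ 2) hβ Finset.univ x₀
    (Finset.mem_univ _) (hmx x₀).le hi
  simp only [clus_univ] at hfin
  rw [expect_sub, expect_mul] at hfin
  linarith

/-- derivative of `vv` -/
def dv (γ : ℝ) (n : ℕ) : ℝ := ∑ j ∈ Finset.range n, -((j : ℝ) * (1 - γ) ^ (j - 1))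

theorem vv_deriv (γ : ℝ) (n : ℕ) : HasDerivAt (fun g => vv g n) (dv γ n) γ := by
  unfold vv dv
  refine HasDerivAt.fun_sum fun j _ => ?_
  have h := ((hasDerivAt_id' γ).const_sub 1).fun_pow j
  exact h.congr_deriv (by ring)

theorem dv_tt (γ : ℝ) (n : ℕ) : tt γ n = -(γ ^ 2 * dv γ n) := by
  induction n with
  | zero => simp [tt, oo, dv]
  | succ n ih =>
    have : dv γ (n + 1) = dv γ n - n * (1 - γ) ^ (n - 1) := by
      unfold dv; rw [Finset.sum_range_succ]; ring
    rw [this, mul_sub, neg_sub, sub_eq_add_neg, ← ih]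
    unfold tt oo
    rcases n with _ | n
    · simp
    · simp only [Nat.add_sub_cancel]
      push_cast
      ring

theorem ode (R R' : ℝ → ℝ) (γ c : ℝ) (hγ : 0 ≤ γ) (hd : ∀ g, HasDerivAt R (R' g) g)
    (h1 : ∀ g ∈ Set.Icc 0 γ, 1 ≤ R g) (hR : ∀ g ∈ Set.Ioo 0 γ, -R' g ≤ c * R g ^ 3) :
    ((R γ)⁻¹) ^ 2 ≤ ((R 0)⁻¹) ^ 2 + 2 * c * γ := by
  have hder : ∀ g ∈ Set.Icc 0 γ, HasDerivAt (fun g => ((R g)⁻¹) ^ 2) (-2 * R' g / R g ^ 3) g := by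
    intro g hg
    have hne : R g ≠ 0 := by linarith [h1 g hg]
    refine (((hd g).fun_inv hne).fun_pow 2).congr_deriv ?_
    simp only [Nat.cast_ofNat, Nat.add_one_sub_one, pow_one]
    field_simp
  have := Convex.image_sub_le_mul_sub_of_deriv_le (convex_Icc 0 γ) (f := fun g => ((R g)⁻¹) ^ 2)
    (fun g hg => (hder g hg).continuousAt.continuousWithinAt)
    (fun g hg => (hder g (interior_subset hg)).differentiableAt.differentiableWithinAt)
    (C := 2 * c) (fun g hg => by
      rw [(hder g (interior_subset hg)).deriv]
      have hpos : 0 < R g := by linarith [h1 g (interior_subset hg)]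
      rw [interior_Icc] at hg
      rw [div_le_iff₀ (by positivity)]
      linarith [hR g hg]) 0 ⟨le_refl _, hγ⟩ γ ⟨hγ, le_refl _⟩ hγ
  simp only [sub_zero] at this
  linarith

theorem quad_bound (G : SimpleGraph V) [DecidableRel G.Adj] (htrans : IsTransitive G)
    (Ω : ℕ) (hreg : G.IsRegularOfDegree Ω) (x₀ : V) (p γ : ℝ) (hp0 : 0 ≤ p) (hp1 : p ≤ 1)
    (h0 : 0 < γ) (h1 : γ < 1) (c : ℝ) (hc : c = 1 ∨ c = Ω * p) :
    1 ≤ chi G x₀ p ∧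
    γ ≤ expect G p (fun ω => 1 - (1 - γ) ^ (cluster G ω x₀).card) ∧
    γ ^ 2 ≤ (expect G p (fun ω => 1 - (1 - γ) ^ (cluster G ω x₀).card)) ^ 2 *
      (((chi G x₀ p)⁻¹) ^ 2 + 2 * c * γ) := by
  let R : ℝ → ℝ := fun g => expect G p (fun ω => vv g (cluster G ω x₀).card)
  let R' : ℝ → ℝ := fun g => expect G p (fun ω => dv g (cluster G ω x₀).card)
  have hpos : ∀ ω, 1 ≤ (cluster G ω x₀).card := by
    intro ω
    rw [← clus_univ]
    exact Finset.card_pos.2 ⟨x₀, self_mem_clus⟩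
  have hd : ∀ g, HasDerivAt R (R' g) g := by
    intro g
    refine HasDerivAt.fun_sum fun ω _ => ?_
    exact (vv_deriv g _).const_mul _
  have hR1 : ∀ g ≤ 1, 1 ≤ R g := by
    intro g hg
    rw [← expect_one G p]
    refine expect_mono G p hp0 hp1 _ _ fun ω => ?_
    obtain ⟨k, hk⟩ := Nat.exists_eq_add_of_le (hpos ω)
    rw [hk, vv_add]
    have := mul_nonneg (pow_nonneg (sub_nonneg.2 hg) 1) (vv_nonneg g hg k)
    have e : vv g 1 = 1 := by simp [vv]
    linarith
  have hMR : ∀ g, expect G p (fun ω => 1 - (1 - g) ^ (cluster G ω x₀).card) = g * R g := by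
    intro g
    simp only [← vv_mul]
    rw [expect_mul]
  have hR0 : R 0 = chi G x₀ p := by
    simp [R, chi, vv]
  have hineq : ∀ g ∈ Set.Ioo 0 γ, -R' g ≤ c * R g ^ 3 := by
    intro g hg
    have h := key_ineq G htrans Ω hreg x₀ p g hp0 hp1 hg.1 (hg.2.trans h1) c hc
    rw [hMR] at h
    have e : expect G p (fun ω => tt g (cluster G ω x₀).card) = g ^ 2 * -R' g := by
      have : ∀ ω, tt g (cluster G ω x₀).card = -g ^ 2 * dv g (cluster G ω x₀).card := by
        intro ω; rw [dv_tt]; ring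
      simp only [this]
      rw [expect_mul]; ring
    rw [e] at h
    have hg2 : 0 < g ^ 2 := pow_pos hg.1 2
    refine le_of_mul_le_mul_left ?_ hg2
    refine h.trans (le_of_eq ?_)
    show c * (g * R g) ^ 2 * R g = _
    ring
  have hfin := ode R R' γ c h0.le hd (fun g hg => hR1 g (hg.2.trans h1.le)) hineq
  rw [hR0] at hfin
  have hRγ := hR1 γ h1.le
  rw [hMR]
  refine ⟨by rw [← hR0]; exact hR1 0 zero_le_one, by nlinarith, ?_⟩
  have : γ ^ 2 = (γ * R γ) ^ 2 * ((R γ)⁻¹) ^ 2 := by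
    have : R γ ≠ 0 := by linarith
    field_simp
  rw [this]
  exact mul_le_mul_of_nonneg_left hfin (sq_nonneg _)

theorem magnetization_eq (G : SimpleGraph V) (x₀ : V) (p γ : ℝ) :
    magnetization G x₀ p γ = expect G p (fun ω => 1 - (1 - γ) ^ (cluster G ω x₀).card) := by
  unfold magnetization prob expect
  simp only [Finset.mul_sum]
  rw [Finset.sum_comm]
  refine Finset.sum_congr rfl fun ω _ => ?_
  rw [Finset.sum_eq_single (cluster G ω x₀).card]
  · simp; ring
  · intro b _ hb
    simp [Ne.symm hb]
  · intro h
    refine absurd (Finset.mem_Icc.2 ⟨?_, Finset.card_le_univ _⟩) h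
    rw [← clus_univ]
    exact Finset.card_pos.2 ⟨x₀, self_mem_clus⟩

theorem final_calc (K γ M χ c : ℝ) (hK1 : 1 ≤ K) (hKc : 2 * c ≤ K) (h0 : 0 < γ)
    (hχ : 1 ≤ χ) (hM : γ ≤ M) (hq : γ ^ 2 ≤ M ^ 2 * ((χ⁻¹) ^ 2 + 2 * c * γ)) :
    (1 / (2 * K)) * (Real.sqrt (4 * K * γ + (χ⁻¹) ^ 2) - χ⁻¹) ≤ M ∧
      ((Real.sqrt (4 * K + 1) - 1) / (2 * K)) * min (Real.sqrt γ) (γ * χ) ≤ M := by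
  have hMpos : 0 < M := by linarith
  have hx : 0 < χ⁻¹ := inv_pos.2 (by linarith)
  have hquad : γ ≤ M * χ⁻¹ + K * M ^ 2 := by
    by_contra! hcon
    have e1 : M * χ⁻¹ < γ := by nlinarith [sq_nonneg M]
    have e2 : M * χ⁻¹ * (M * χ⁻¹) ≤ M * χ⁻¹ * γ := mul_le_mul_of_nonneg_left e1.le (by positivity)
    have e3 : (M * χ⁻¹ + K * M ^ 2) * γ < γ * γ := mul_lt_mul_of_pos_right hcon h0
    have e4 : 2 * c * (M ^ 2 * γ) ≤ K * (M ^ 2 * γ) :=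
      mul_le_mul_of_nonneg_right hKc (by positivity)
    nlinarith
  have hK0 : 0 < K := by linarith
  constructor
  · rw [one_div, inv_mul_le_iff₀ (by positivity), sub_le_iff_le_add]
    refine Real.sqrt_le_iff.2 ⟨by positivity, ?_⟩
    nlinarith [mul_le_mul_of_nonneg_left hquad hK0.le]
  · set r := (Real.sqrt (4 * K + 1) - 1) / (2 * K) with hr
    have hs := Real.sq_sqrt (by linarith : (0 : ℝ) ≤ 4 * K + 1)
    have hs1 : 1 ≤ Real.sqrt (4 * K + 1) := Real.one_le_sqrt.2 (by linarith)
    have hr0 : 0 ≤ r := div_nonneg (by linarith) (by positivity)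
    have hr1 : K * r ^ 2 + r = 1 := by
      have h2 : 2 * K * r = Real.sqrt (4 * K + 1) - 1 := by rw [hr]; field_simp
      have h3 : Real.sqrt (4 * K + 1) = 2 * K * r + 1 := by linarith
      rw [h3] at hs
      have h4 : 4 * K * (K * r ^ 2 + r) = 4 * K * 1 := by linarith
      exact mul_left_cancel₀ (by positivity) h4
    by_contra! hcon
    set s := min (Real.sqrt γ) (γ * χ) with hsdef
    have hs0 : 0 ≤ s := le_min (Real.sqrt_nonneg _) (by positivity)
    have hsa : s ^ 2 ≤ γ := by
      have := pow_le_pow_left₀ hs0 (min_le_left (Real.sqrt γ) (γ * χ)) 2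
      rwa [Real.sq_sqrt h0.le] at this
    have hsb : s * χ⁻¹ ≤ γ := by
      have h := mul_le_mul_of_nonneg_right (min_le_right (Real.sqrt γ) (γ * χ)) hx.le
      have hne : χ ≠ 0 := by linarith
      rwa [mul_inv_cancel_right₀ hne] at h
    have a1 : M ^ 2 < (r * s) ^ 2 := by
      exact pow_lt_pow_left₀ hcon hMpos.le (by norm_num)
    have a2 : M * χ⁻¹ < r * s * χ⁻¹ := mul_lt_mul_of_pos_right hcon hx
    have a3 : r * (s * χ⁻¹) ≤ r * γ := mul_le_mul_of_nonneg_left hsb hr0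
    have a4 : K * r ^ 2 * s ^ 2 ≤ K * r ^ 2 * γ := mul_le_mul_of_nonneg_left hsa (by positivity)
    have a5 : K * M ^ 2 < K * (r * s) ^ 2 := mul_lt_mul_of_pos_left a1 hK0
    have a6 : (K * r ^ 2 + r) * γ = γ := by rw [hr1, one_mul]
    nlinarith

end Helpers
end Percolation

open Percolation in
/-- Proposition 4.1(i): lower bounds on the magnetization. -/
theorem magnetization_lower_bound
    {V : Type*} [Fintype V] [DecidableEq V]
    (G : SimpleGraph V) [DecidableRel G.Adj]
    (hconn : G.Connected) (htrans : IsTransitive G)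
    (Ω : ℕ) (hreg : G.IsRegularOfDegree Ω)
    (x₀ : V)
    (p : ℝ) (hp0 : 0 < p) (hp1 : p < 1)
    (γ : ℝ) (hγ0 : 0 < γ) (hγ1 : γ < 1)
    (K : ℝ) (hK : K = 1 + (Ω : ℝ) * p / (1 - p)) :
    (1 / (2 * K)) *
        (Real.sqrt (4 * K * γ + ((chi G x₀ p)⁻¹) ^ 2) - (chi G x₀ p)⁻¹) ≤
      magnetization G x₀ p γ ∧
      ((Real.sqrt (4 * K + 1) - 1) / (2 * K)) *
          min (Real.sqrt γ) (γ * chi G x₀ p) ≤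
        magnetization G x₀ p γ := by
  have hq : 0 < 1 - p := by linarith
  have ha : (Ω : ℝ) * p ≤ (Ω : ℝ) * p / (1 - p) := by
    rw [le_div_iff₀ hq]
    have : 0 ≤ (Ω : ℝ) * p * p := by positivity
    nlinarith
  have ha0 : 0 ≤ (Ω : ℝ) * p := by positivity
  have hc : ∃ c : ℝ, (c = 1 ∨ c = (Ω : ℝ) * p) ∧ 2 * c ≤ K := by
    by_cases h : (Ω : ℝ) * p ≤ 1
    · exact ⟨(Ω : ℝ) * p, Or.inr rfl, by linarith⟩
    · exact ⟨1, Or.inl rfl, by linarith⟩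
  obtain ⟨c, hc, hcK⟩ := hc
  obtain ⟨h1, h2, h3⟩ := quad_bound G htrans Ω hreg x₀ p γ hp0.le hp1.le hγ0 hγ1 c hc
  rw [magnetization_eq]
  exact final_calc K γ _ _ c (by linarith) hcK hγ0 h1 h2 h3
end
end
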